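/- arXiv:0811.3649 — 4 statements merged into one kernel-verified Lean document; each statement's English description precedes it below -/
import Mathlib

section
/- For a monic irreducible polynomial P of degree n ≥ 2 in F_q[x] and α ≥ 0, the sum σ_n(α) = Σ_{deg A = α, gcd(A,P)=1} μ(A) over monic A equals 1 if α ≡ 0 (mod n), equals -q if α ≡ 1 (mod n), and equals 0 otherwise. -/
open Polynomial UniqueFactorizationMonoid
open scoped Classical

/-- The Möbius function for polynomials over a field. -/
noncomputable def polyMoebius {F : Type*} [Field F] (A : F[X]) : ℤ :=
  if Squarefree A then (-1) ^ (normalizedFactors A).card else 0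

section PolyMoebius

variable {F : Type*} [Field F]

theorem polyMoebius_one : polyMoebius (1 : F[X]) = 1 := by
  simp [polyMoebius]

theorem polyMoebius_irreducible_mul {P B : F[X]} (hP : Irreducible P) :
    polyMoebius (P * B) = if IsCoprime B P then -polyMoebius B else 0 := by
  unfold polyMoebius
  rw [squarefree_mul_iff, isRelPrime_comm, isRelPrime_iff_isCoprime]
  by_cases hc : IsCoprime B P
  · by_cases hB : Squarefree B
    · rw [normalizedFactors_mul hP.ne_zero hB.ne_zero, normalizedFactors_irreducible hP]
      simp [hc, hB, hP.squarefree, pow_add]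
    · simp [hB]
  · simp [hc]

theorem isCoprime_iff_not_dvd_of_irreducible {P A : F[X]} (hP : Irreducible P) :
    IsCoprime A P ↔ ¬ P ∣ A := by
  rw [isCoprime_comm, hP.coprime_iff_not_dvd]

variable [Fintype F]

variable (F) in
theorem finite_setOf_monic_natDegree_eq (k : ℕ) :
    {A : F[X] | A.Monic ∧ A.natDegree = k}.Finite :=
  Finite.of_equiv (Fin k → F)
    ((monicEquivDegreeLT k).trans (degreeLTEquiv F k).toEquiv).symm

variable (F) in
/-- The finset of monic polynomials of degree `k` over a finite field. -/
noncomputable def monicsOfDegree (k : ℕ) : Finset F[X] :=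
  (finite_setOf_monic_natDegree_eq F k).toFinset

variable (F) in
/-- The finset of monic polynomials of degree at most `m` over a finite field. -/
noncomputable def monicsOfDegreeLE (m : ℕ) : Finset F[X] :=
  (Finset.range (m + 1)).biUnion (monicsOfDegree F)

@[simp]
theorem mem_monicsOfDegree {k : ℕ} {A : F[X]} :
    A ∈ monicsOfDegree F k ↔ A.Monic ∧ A.natDegree = k := by
  simp [monicsOfDegree]

@[simp]
theorem mem_monicsOfDegreeLE {m : ℕ} {A : F[X]} :
    A ∈ monicsOfDegreeLE F m ↔ A.Monic ∧ A.natDegree ≤ m := by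
  simp only [monicsOfDegreeLE, Finset.mem_biUnion, Finset.mem_range, mem_monicsOfDegree]
  grind

theorem monicsOfDegree_zero : monicsOfDegree F 0 = {1} := by
  ext A
  simp only [mem_monicsOfDegree, Finset.mem_singleton]
  exact ⟨fun h => h.1.natDegree_eq_zero.mp h.2, by rintro rfl; simp⟩

theorem card_monicsOfDegree (k : ℕ) : (monicsOfDegree F k).card = Fintype.card F ^ k := by
  rw [monicsOfDegree, ← Set.ncard_eq_toFinset_card _ (finite_setOf_monic_natDegree_eq F k),
    ← Nat.card_coe_set_eq]
  exact (Nat.card_congr ((monicEquivDegreeLT k).trans (degreeLTEquiv F k).toEquiv)).trans (by simp)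

/-- The monic multiples of degree `k` of a monic polynomial `A`. -/
theorem filter_dvd_monicsOfDegree {A : F[X]} (hA : A.Monic) {k : ℕ} (hk : A.natDegree ≤ k) :
    {C ∈ monicsOfDegree F k | A ∣ C} = (monicsOfDegree F (k - A.natDegree)).image (A * ·) := by
  ext C
  simp only [Finset.mem_filter, mem_monicsOfDegree, Finset.mem_image]
  constructor
  · rintro ⟨⟨hC, hd⟩, B, rfl⟩
    have hB : B.Monic := hA.of_mul_monic_left hC
    rw [hA.natDegree_mul hB] at hd
    exact ⟨B, ⟨hB, by omega⟩, rfl⟩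
  · rintro ⟨B, ⟨hB, hd⟩, rfl⟩
    exact ⟨⟨hA.mul hB, by rw [hA.natDegree_mul hB]; omega⟩, dvd_mul_right A B⟩

theorem card_filter_dvd_monicsOfDegree {A : F[X]} (hA : A.Monic) {k : ℕ}
    (hk : A.natDegree ≤ k) :
    {C ∈ monicsOfDegree F k | A ∣ C}.card = Fintype.card F ^ (k - A.natDegree) := by
  rw [filter_dvd_monicsOfDegree hA hk,
    Finset.card_image_of_injective _ (mul_right_injective₀ hA.ne_zero), card_monicsOfDegree]

theorem sum_polyMoebius_dvd {C : F[X]} {m : ℕ} (hC : C ∈ monicsOfDegree F (m + 1)) :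
    ∑ A ∈ monicsOfDegreeLE F (m + 1) with A ∣ C, polyMoebius A = 0 := by
  rw [mem_monicsOfDegree] at hC
  obtain ⟨P, hPm, hPirr, hPC⟩ := exists_monic_irreducible_factor C
    (fun h => by have := natDegree_eq_zero_of_isUnit h; omega)
  rw [← Finset.sum_filter_of_ne (p := Squarefree)
    (fun A _ h => by by_contra hs; exact h (by simp [polyMoebius, hs]))]
  have hle {A : F[X]} (h : A ∣ C) : A.natDegree ≤ m + 1 :=
    hC.2 ▸ natDegree_le_of_dvd h hC.1.ne_zero
  have hdiv (B : F[X]) : P * B / P = B := mul_div_cancel_left₀ B hPirr.ne_zero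
  have hcop {B : F[X]} (h : Squarefree (P * B)) : ¬ P ∣ B := by
    rw [← isCoprime_iff_not_dvd_of_irreducible hPirr, ← isRelPrime_iff_isCoprime]
    exact (squarefree_mul_iff.mp h).1.symm
  refine Finset.sum_involution (fun A _ => if P ∣ A then A / P else P * A) ?_ ?_ ?_ ?_
  all_goals
    intro A hA
    simp only [Finset.mem_filter, mem_monicsOfDegreeLE] at hA
    obtain ⟨⟨⟨hAm, -⟩, hAC⟩, hAs⟩ := hA
    by_cases hPA : P ∣ A
  · obtain ⟨B, rfl⟩ := hPA
    simp [hdiv, polyMoebius_irreducible_mul hPirr,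
      isCoprime_iff_not_dvd_of_irreducible hPirr, hcop hAs]
  · simp [hPA, polyMoebius_irreducible_mul hPirr, isCoprime_iff_not_dvd_of_irreducible hPirr]
  · obtain ⟨B, rfl⟩ := hPA
    intro _ h
    simp only [dvd_mul_right, if_true, hdiv] at h
    exact hcop hAs (h ▸ dvd_mul_right P B)
  · intro _ h
    simp only [hPA, if_false] at h
    exact hPA (h ▸ dvd_mul_right P A)
  · obtain ⟨B, rfl⟩ := hPA
    have hBC : B ∣ C := (dvd_mul_left B P).trans hAC
    simp only [dvd_mul_right, if_true, hdiv, Finset.mem_filter, mem_monicsOfDegreeLE]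
    exact ⟨⟨⟨hPm.of_mul_monic_left hAm, hle hBC⟩, hBC⟩, hAs.of_mul_right⟩
  · have hco := (isCoprime_iff_not_dvd_of_irreducible hPirr).mpr hPA
    have hPAC : P * A ∣ C := hco.symm.mul_dvd hPC hAC
    simp only [hPA, if_false, Finset.mem_filter, mem_monicsOfDegreeLE]
    exact ⟨⟨⟨hPm.mul hAm, hle hPAC⟩, hPAC⟩,
      squarefree_mul_iff.mpr ⟨hco.symm.isRelPrime, hPirr.squarefree, hAs⟩⟩
  · obtain ⟨B, rfl⟩ := hPA
    simp [hdiv, hcop hAs]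
  · simp [hPA, hdiv]

/-- The coefficients of the product of the Dirichlet series of `1` and of the Möbius function. -/
theorem sum_polyMoebius_mul_card_pow (m : ℕ) :
    ∑ A ∈ monicsOfDegreeLE F m, polyMoebius A * (Fintype.card F : ℤ) ^ (m - A.natDegree) =
      if m = 0 then 1 else 0 := by
  have key :
      ∑ A ∈ monicsOfDegreeLE F m, polyMoebius A * (Fintype.card F : ℤ) ^ (m - A.natDegree) =
      ∑ C ∈ monicsOfDegree F m, ∑ A ∈ monicsOfDegreeLE F m with A ∣ C, polyMoebius A := by
    simp_rw [Finset.sum_filter]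
    rw [Finset.sum_comm]
    refine Finset.sum_congr rfl fun A hA => ?_
    rw [mem_monicsOfDegreeLE] at hA
    rw [← Finset.sum_filter, Finset.sum_const, card_filter_dvd_monicsOfDegree hA.1 hA.2]
    simp [mul_comm]
  rcases m with _ | m
  · simp [monicsOfDegreeLE, monicsOfDegree_zero, polyMoebius_one]
  · rw [key, Finset.sum_eq_zero fun C hC => sum_polyMoebius_dvd hC]
    simp

theorem sum_polyMoebius_monicsOfDegree (k : ℕ) :
    ∑ A ∈ monicsOfDegree F k, polyMoebius A =
      if k = 0 then 1 else if k = 1 then -(Fintype.card F : ℤ) else 0 := by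
  rcases k with _ | k
  · simp [monicsOfDegree_zero, polyMoebius_one]
  have hsplit : monicsOfDegreeLE F (k + 1) = monicsOfDegreeLE F k ∪ monicsOfDegree F (k + 1) := by
    rw [monicsOfDegreeLE, Finset.range_add_one, Finset.biUnion_insert, Finset.union_comm,
      monicsOfDegreeLE]
  have hdisj : Disjoint (monicsOfDegreeLE F k) (monicsOfDegree F (k + 1)) :=
    Finset.disjoint_left.mpr fun A h₁ h₂ => by simp at h₁ h₂; omega
  have h := sum_polyMoebius_mul_card_pow (F := F) (k + 1)
  rw [hsplit, Finset.sum_union hdisj] at h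
  have h₁ : ∑ A ∈ monicsOfDegreeLE F k,
      polyMoebius A * (Fintype.card F : ℤ) ^ (k + 1 - A.natDegree) =
      (if k = 0 then 1 else 0) * (Fintype.card F : ℤ) := by
    rw [← sum_polyMoebius_mul_card_pow (F := F) k, Finset.sum_mul]
    refine Finset.sum_congr rfl fun A hA => ?_
    rw [Nat.succ_sub (mem_monicsOfDegreeLE.mp hA).2, pow_succ, mul_assoc]
  have h₂ : ∑ A ∈ monicsOfDegree F (k + 1),
      polyMoebius A * (Fintype.card F : ℤ) ^ (k + 1 - A.natDegree) =
      ∑ A ∈ monicsOfDegree F (k + 1), polyMoebius A :=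
    Finset.sum_congr rfl fun A hA => by simp [(mem_monicsOfDegree.mp hA).2]
  rw [h₁, h₂] at h
  by_cases hk : k = 0 <;> simp [hk] at h ⊢ <;> linarith

/-- Splitting off the multiples of `P` relates the sum over all monic polynomials to the sums over
those coprime to `P`. -/
theorem sum_polyMoebius_monicsOfDegree_eq {P : F[X]} (hP : P.Monic) (hirr : Irreducible P)
    (k : ℕ) :
    ∑ A ∈ monicsOfDegree F k, polyMoebius A =
      ∑ A ∈ monicsOfDegree F k with IsCoprime A P, polyMoebius A -
        if P.natDegree ≤ k then
          ∑ A ∈ monicsOfDegree F (k - P.natDegree) with IsCoprime A P, polyMoebius A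
        else 0 := by
  rw [← Finset.sum_filter_add_sum_filter_not _ (fun A => IsCoprime A P), sub_eq_add_neg]
  congr 1
  simp only [isCoprime_iff_not_dvd_of_irreducible hirr, not_not]
  split_ifs with hk
  · rw [filter_dvd_monicsOfDegree hP hk,
      Finset.sum_image (mul_right_injective₀ hP.ne_zero).injOn, ← Finset.sum_neg_distrib,
      Finset.sum_filter]
    simp only [polyMoebius_irreducible_mul hirr, isCoprime_iff_not_dvd_of_irreducible hirr]
  · rw [neg_zero]
    refine Finset.sum_eq_zero fun A hA => absurd ?_ hk
    simp only [Finset.mem_filter, mem_monicsOfDegree] at hA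
    exact hA.1.2 ▸ natDegree_le_of_dvd hA.2 hA.1.1.ne_zero

end PolyMoebius

/-- For a monic irreducible `P` of degree `n ≥ 2`, the sum
`σ_n(α) = Σ_{deg A = α, gcd(A,P)=1} μ(A)` over monic `A` equals `1` if
`α ≡ 0 (mod n)`, `-q` if `α ≡ 1 (mod n)`, and `0` otherwise. -/
theorem sum_polyMoebius_coprime (F : Type*) [Field F] [Fintype F]
    (P : F[X]) (hP : P.Monic) (hirr : Irreducible P) (n : ℕ) (hn : P.natDegree = n)
    (hn2 : 2 ≤ n) (α : ℕ) :
    (∑ᶠ A ∈ {A : F[X] | A.Monic ∧ A.natDegree = α ∧ IsCoprime A P}, polyMoebius A) =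
      if α % n = 0 then 1 else if α % n = 1 then -(Fintype.card F : ℤ) else 0 := by
  have hset : {A : F[X] | A.Monic ∧ A.natDegree = α ∧ IsCoprime A P} =
      ({A ∈ monicsOfDegree F α | IsCoprime A P} : Finset F[X]) := by
    ext A
    simp [and_assoc]
  rw [hset, finsum_mem_coe_finset]
  clear hset
  induction α using Nat.strong_induction_on with
  | _ α ih =>
    have h := sum_polyMoebius_monicsOfDegree_eq hP hirr α
    rw [sum_polyMoebius_monicsOfDegree, hn] at h
    by_cases hα : n ≤ α
    · rw [if_pos hα, ih (α - n) (by omega), if_neg (by omega), if_neg (by omega),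
        ← Nat.mod_eq_sub_mod hα] at h
      linarith
    · rw [if_neg hα, sub_zero] at h
      rw [← h, Nat.mod_eq_of_lt (not_le.mp hα)]
end

section
/- For q odd and n odd, S(n−1; n) = π_q(n)·q^{(n−1)/2}, where S(β; n) = Σ_{P monic irreducible of degree n} Σ_{B monic of degree β} (B/P) and π_q(n) is the number of monic irreducible polynomials of degree n over F_q. -/
open Polynomial
open scoped Classical

/-- The quadratic residue symbol `(B/P)` for `P` a monic irreducible polynomial:
`0` if `P ∣ B`, `1` if `B` is a nonzero square modulo `P`, and `-1` otherwise. -/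
noncomputable def legendreSymbol {F : Type*} [Field F] (B P : F[X]) : ℤ :=
  if P ∣ B then 0 else if ∃ C : F[X], P ∣ (C ^ 2 - B) then 1 else -1

/-- The double character sum
`S(β; n) = Σ_{P monic irreducible, deg P = n} Σ_{B monic, deg B = β} (B/P)`. -/
noncomputable def doubleCharSum (F : Type*) [Field F] (β n : ℕ) : ℤ :=
  ∑ᶠ P ∈ {P : F[X] | P.Monic ∧ Irreducible P ∧ P.natDegree = n},
    ∑ᶠ B ∈ {B : F[X] | B.Monic ∧ B.natDegree = β}, legendreSymbol B P

/-- `π_q(n)`, the number of monic irreducible polynomials of degree `n`. -/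
noncomputable def primeCount (F : Type*) [Field F] (n : ℕ) : ℕ :=
  {P : F[X] | P.Monic ∧ Irreducible P ∧ P.natDegree = n}.ncard

/-- All fibres of a nonzero linear functional on a finite vector space have the same size. -/
theorem card_mul_card_fiber {F V : Type*} [Field F] [Fintype F] [AddCommGroup V] [Module F V]
    [Fintype V] (f : V →ₗ[F] F) (hf : f ≠ 0) (a : F) :
    Fintype.card F * (Finset.univ.filter fun v => f v = a).card = Fintype.card V := by
  have hs : Function.Surjective f := LinearMap.surjective hf
  have h := Finset.card_eq_sum_card_fiberwise (f := f) (s := Finset.univ) (t := Finset.univ)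
    (fun _ _ => by simp)
  rw [Finset.sum_congr rfl fun b _ =>
    AddMonoidHom.card_fiber_eq_of_mem_range f (hs b) (hs a)] at h
  simpa using h.symm

/-- Counting solutions of `e (C ^ 2) = 1` by averaging over translates by a totally isotropic
subspace `U`. -/
theorem card_mul_card_sq_eq_one {F K : Type*} [Field F] [Fintype F] [CommRing K] [Algebra F K]
    [Fintype K] (h2 : (2 : F) ≠ 0) (e : K →ₗ[F] F) (U : Submodule F K)
    (hU : ∀ A ∈ U, ∀ B ∈ U, e (A * B) = 0) :
    Fintype.card F * (Finset.univ.filter fun C : K => e (C ^ 2) = 1).card =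
      Fintype.card F *
        (Finset.univ.filter fun C : K => (∀ A ∈ U, e (A * C) = 0) ∧ e (C ^ 2) = 1).card +
      (Finset.univ.filter fun C : K => ¬ ∀ A ∈ U, e (A * C) = 0).card := by
  have translate (A : U) : (Finset.univ.filter fun C : K => e ((C + A) ^ 2) = 1).card =
      (Finset.univ.filter fun C : K => e (C ^ 2) = 1).card :=
    Finset.card_equiv (Equiv.addRight (A : K)) (by simp)
  have expand (C : K) (A : U) : e ((C + A) ^ 2) = e (C ^ 2) + 2 * e (A * C) := by
    have : (C + A) ^ 2 = C ^ 2 + (2 : F) • ((A : K) * C) + A * A := by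
      rw [two_smul]; ring
    rw [this, map_add, map_add, hU A A.2 A A.2, map_smul, smul_eq_mul, add_zero]
  have fiber (C : K) :
      Fintype.card F * (Finset.univ.filter fun A : U => e ((C + A) ^ 2) = 1).card =
        Fintype.card U *
          (Fintype.card F * (if (∀ A ∈ U, e (A * C) = 0) ∧ e (C ^ 2) = 1 then 1 else 0) +
            if ¬ ∀ A ∈ U, e (A * C) = 0 then 1 else 0) := by
    by_cases hC : ∀ A ∈ U, e (A * C) = 0
    · have h (A : U) : e ((C + A) ^ 2) = e (C ^ 2) := by simp [expand, hC A A.2]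
      by_cases h1 : e (C ^ 2) = 1
      · rw [if_pos ⟨hC, h1⟩, if_neg (not_not.mpr hC)]
        simp only [h, h1]
        simpa using mul_comm _ _
      · rw [if_neg (fun h => h1 h.2), if_neg (not_not.mpr hC)]
        simp [h, h1]
    · let f : U →ₗ[F] F := e ∘ₗ (LinearMap.mulRight F C) ∘ₗ U.subtype
      have hf : f ≠ 0 := fun h => hC fun A hA => by
        simpa [f] using LinearMap.congr_fun h ⟨A, hA⟩
      have h := card_mul_card_fiber f hf ((1 - e (C ^ 2)) / 2)
      have hset : (Finset.univ.filter fun A : U => e ((C + A) ^ 2) = 1) =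
          Finset.univ.filter fun A : U => f A = (1 - e (C ^ 2)) / 2 := by
        ext A
        simp only [Finset.mem_filter_univ, expand, eq_div_iff h2]
        simp only [f, LinearMap.comp_apply, LinearMap.mulRight_apply, Submodule.subtype_apply]
        constructor <;> intro h <;> linear_combination h
      rw [hset, h, if_neg (fun h => hC h.1), if_pos hC]
      simp
  have hpos : 0 < Fintype.card U := Fintype.card_pos
  apply Nat.eq_of_mul_eq_mul_left hpos
  calc Fintype.card U * (Fintype.card F * (Finset.univ.filter fun C : K => e (C ^ 2) = 1).card)
      = Fintype.card F *
          ∑ A : U, (Finset.univ.filter fun C : K => e ((C + A) ^ 2) = 1).card := by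
        simp only [translate, Finset.sum_const, Finset.card_univ, smul_eq_mul]; ring
    _ = ∑ C : K, Fintype.card F * (Finset.univ.filter fun A : U => e ((C + A) ^ 2) = 1).card := by
        rw [← Finset.mul_sum]
        simp only [Finset.card_filter]
        rw [Finset.sum_comm]
    _ = _ := by
        simp only [fiber, ← Finset.mul_sum, Finset.sum_add_distrib, ← Finset.card_filter]

/-- The sum of the quadratic character over a fibre of `e`, in terms of counts of points. -/
theorem sum_quadraticChar_fiber {F K : Type*} [Field F] [Field K] [Fintype K]
    [DecidableEq K] (hK : ringChar K ≠ 2) (e : K → F) (a : F) :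
    ∑ b with e b = a, quadraticChar K b =
      ((Finset.univ.filter fun C : K => e (C ^ 2) = a).card : ℤ) -
        (Finset.univ.filter fun b : K => e b = a).card := by
  have h := Finset.card_eq_sum_card_fiberwise (f := fun C : K => C ^ 2)
    (s := Finset.univ.filter fun C : K => e (C ^ 2) = a)
    (t := Finset.univ.filter fun b : K => e b = a) (fun C hC => by simpa using hC)
  have hb (b : K) (hb : b ∈ Finset.univ.filter fun b : K => e b = a) :
      (((Finset.univ.filter fun C : K => e (C ^ 2) = a).filter fun C => C ^ 2 = b).card : ℤ) =
        quadraticChar K b + 1 := by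
    rw [← quadraticChar_card_sqrts hK]
    congr 2
    ext C
    simp only [Finset.mem_filter, Finset.mem_univ, true_and] at hb ⊢
    simp only [Set.mem_toFinset, Set.mem_ofPred_eq, and_iff_right_iff_imp]
    rintro rfl
    simpa using hb
  rw [h, Nat.cast_sum, Finset.sum_congr rfl hb]
  simp [Finset.sum_add_distrib]

theorem legendreSymbol_eq_quadraticChar {F : Type*} [Field F] (B P : F[X])
    [Fact (Irreducible P)] [Fintype (AdjoinRoot P)] :
    legendreSymbol B P = quadraticChar (AdjoinRoot P) (AdjoinRoot.mk P B) := by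
  have hsq : (∃ C : F[X], P ∣ (C ^ 2 - B)) ↔ IsSquare (AdjoinRoot.mk P B) := by
    rw [isSquare_iff_exists_sq, AdjoinRoot.mk_surjective.exists]
    refine exists_congr fun C => ?_
    rw [← map_pow, eq_comm, AdjoinRoot.mk_eq_mk]
  rw [legendreSymbol, quadraticChar_apply, quadraticCharFun]
  simp only [hsq, AdjoinRoot.mk_eq_zero]

instance {F : Type*} [Field F] [Finite F] (n : ℕ) : Finite (degreeLT F n) :=
  Finite.of_equiv _ (degreeLTEquiv F n).symm.toEquiv

theorem card_degreeLT {F : Type*} [Field F] [Fintype F] (n : ℕ) [Fintype (degreeLT F n)] :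
    Fintype.card (degreeLT F n) = Fintype.card F ^ n := by
  rw [Fintype.card_congr (degreeLTEquiv F n).toEquiv]
  simp

theorem mk_injOn_degree_lt {F : Type*} [Field F] {P : F[X]} :
    Set.InjOn (AdjoinRoot.mk P) {c | c.degree < P.degree} := by
  intro c hc d hd h
  have := Polynomial.eq_zero_of_dvd_of_degree_lt (AdjoinRoot.mk_eq_mk.mp h)
    (lt_of_le_of_lt (degree_sub_le c d) (max_lt hc hd))
  exact sub_eq_zero.mp this

/-- The functional reading off the coefficient of `X ^ k` in the reduced representative. -/
noncomputable def reducedCoeff {F : Type*} [Field F] {P : F[X]} (hP : P.Monic) (k : ℕ) :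
    AdjoinRoot P →ₗ[F] F :=
  lcoeff F k ∘ₗ AdjoinRoot.modByMonicHom hP

theorem reducedCoeff_mk {F : Type*} [Field F] {P : F[X]} (hP : P.Monic) (k : ℕ) {c : F[X]}
    (hc : c.degree < P.degree) : reducedCoeff hP k (AdjoinRoot.mk P c) = c.coeff k := by
  simp [reducedCoeff, (modByMonic_eq_self_iff hP).mpr hc]

theorem exists_degree_lt_mk_eq {F : Type*} [Field F] {P : F[X]} (hP : P.Monic)
    (x : AdjoinRoot P) : ∃ c : F[X], c.degree < P.degree ∧ AdjoinRoot.mk P c = x :=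
  ⟨AdjoinRoot.modByMonicHom hP x, by
    obtain ⟨c, rfl⟩ := AdjoinRoot.mk_surjective x
    exact degree_modByMonic_lt _ hP, AdjoinRoot.mk_leftInverse hP x⟩

theorem card_filter_mk {F : Type*} [Field F] [Finite F] {P : F[X]} (hP : P.Monic)
    [Fintype (AdjoinRoot P)] {r : ℕ} [Fintype (degreeLT F r)] (hr : r ≤ P.natDegree)
    (p : AdjoinRoot P → Prop) [DecidablePred p] (p' : F[X] → Prop)
    (h : ∀ c : F[X], c.degree < P.degree → (p (AdjoinRoot.mk P c) ↔ c.degree < r ∧ p' c)) :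
    (Finset.univ.filter p).card = (Finset.univ.filter fun c : degreeLT F r => p' c).card := by
  have hlt (c : F[X]) (hc : c.degree < r) : c.degree < P.degree := by
    rw [degree_eq_natDegree hP.ne_zero]
    exact hc.trans_le (by exact_mod_cast hr)
  symm
  refine Finset.card_bij (fun c _ => AdjoinRoot.mk P c) ?_ ?_ ?_
  · intro c hc
    have := mem_degreeLT.mp c.2
    simp only [Finset.mem_filter, Finset.mem_univ, true_and] at hc ⊢
    exact (h c (hlt c this)).mpr ⟨this, hc⟩
  · intro c _ d _ hcd
    exact Subtype.ext (mk_injOn_degree_lt (hlt c (mem_degreeLT.mp c.2))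
      (hlt d (mem_degreeLT.mp d.2)) hcd)
  · intro x hx
    obtain ⟨c, hc, rfl⟩ := exists_degree_lt_mk_eq hP x
    simp only [Finset.mem_filter, Finset.mem_univ, true_and] at hx
    obtain ⟨h1, h2⟩ := (h c hc).mp hx
    exact ⟨⟨c, mem_degreeLT.mpr h1⟩, by simpa using h2, rfl⟩

theorem card_mul_card_coeff_sq_eq_one {F : Type*} [Field F] [Fintype F] (h2 : (2 : F) ≠ 0)
    (m : ℕ) [Fintype (degreeLT F (m + 1))] :
    Fintype.card F * (Finset.univ.filter fun c : degreeLT F (m + 1) =>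
      (c : F[X]).coeff m ^ 2 = 1).card = 2 * Fintype.card F ^ (m + 1) := by
  let f : degreeLT F (m + 1) →ₗ[F] F := lcoeff F m ∘ₗ (degreeLT F (m + 1)).subtype
  have hf : f ≠ 0 := fun h => by
    have hX : (X ^ m : F[X]) ∈ degreeLT F (m + 1) := by
      rw [mem_degreeLT, degree_X_pow]; exact_mod_cast Nat.lt_succ_self m
    simpa [f] using LinearMap.congr_fun h ⟨X ^ m, hX⟩
  have hdisj : Disjoint (Finset.univ.filter fun c => f c = 1)
      (Finset.univ.filter fun c => f c = -1) := by
    rw [Finset.disjoint_filter]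
    intro c _ h1 h3
    exact h2 (by linear_combination h3 - h1)
  have hset : (Finset.univ.filter fun c : degreeLT F (m + 1) => (c : F[X]).coeff m ^ 2 = 1) =
      (Finset.univ.filter fun c => f c = 1) ∪ (Finset.univ.filter fun c => f c = -1) := by
    ext c
    simp only [Finset.mem_union, Finset.mem_filter, Finset.mem_univ, true_and]
    simp [f]
  rw [hset, Finset.card_union_of_disjoint hdisj, mul_add, card_mul_card_fiber f hf,
    card_mul_card_fiber f hf, card_degreeLT]
  ring

theorem reducedCoeff_orthogonal_iff {F : Type*} [Field F] {P : F[X]} (hP : P.Monic) {m : ℕ}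
    (hn : P.natDegree = 2 * m + 1) {c : F[X]} (hc : c.degree < P.degree) :
    (∀ A ∈ (degreeLT F m).map (AdjoinRoot.mkₐ P).toLinearMap,
      reducedCoeff hP (2 * m) (A * AdjoinRoot.mk P c) = 0) ↔ c.degree < (m + 1 : ℕ) := by
  have hdeg : P.degree = (2 * m + 1 : ℕ) := by rw [degree_eq_natDegree hP.ne_zero, hn]
  rw [hdeg] at hc
  constructor
  · intro h
    by_contra hcm
    have hc0 : c ≠ 0 := by rintro rfl; simp at hcm
    rw [degree_eq_natDegree hc0] at hc hcm
    norm_cast at hc hcm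
    have hX : (X ^ (2 * m - c.natDegree) : F[X]) ∈ degreeLT F m := by
      rw [mem_degreeLT, degree_X_pow]; norm_cast; omega
    have h1 := h _ (Submodule.mem_map_of_mem hX)
    have hd : (X ^ (2 * m - c.natDegree) * c).degree < P.degree := by
      rw [degree_mul, degree_X_pow, degree_eq_natDegree hc0, hdeg]; norm_cast; omega
    simp only [AlgHom.toLinearMap_apply, AdjoinRoot.coe_mkₐ, ← map_mul] at h1
    rw [reducedCoeff_mk hP _ hd, coeff_X_pow_mul', if_pos (Nat.sub_le _ _)] at h1
    rw [show 2 * m - (2 * m - c.natDegree) = c.natDegree by omega] at h1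
    exact hc0 (leadingCoeff_eq_zero.mp h1)
  · rintro hcm _ ⟨A, hA, rfl⟩
    have hA' : A.degree < m := mem_degreeLT.mp hA
    have hlt : (A * c).degree < (2 * m : ℕ) := by
      by_cases hA0 : A = 0
      · rw [hA0, zero_mul, degree_zero]; exact WithBot.bot_lt_coe _
      by_cases hc0 : c = 0
      · rw [hc0, mul_zero, degree_zero]; exact WithBot.bot_lt_coe _
      rw [degree_mul]
      rw [degree_eq_natDegree hA0] at hA' ⊢
      rw [degree_eq_natDegree hc0] at hcm ⊢
      norm_cast at hA' hcm ⊢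
      omega
    simp only [AlgHom.toLinearMap_apply, AdjoinRoot.coe_mkₐ, ← map_mul]
    rw [reducedCoeff_mk hP _ (hlt.trans (by rw [hdeg]; norm_cast; omega)),
      coeff_eq_zero_of_degree_lt hlt]

theorem reducedCoeff_sq_of_degree_lt {F : Type*} [Field F] {P : F[X]} (hP : P.Monic) {m : ℕ}
    (hn : P.natDegree = 2 * m + 1) {c : F[X]} (hc : c.degree < (m + 1 : ℕ)) :
    reducedCoeff hP (2 * m) (AdjoinRoot.mk P c ^ 2) = c.coeff m ^ 2 := by
  have hc' : c.natDegree ≤ m :=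
    natDegree_le_of_degree_le (Order.lt_succ_iff.mp (by exact_mod_cast hc))
  rw [← map_pow, reducedCoeff_mk, coeff_pow_of_natDegree_le hc']
  rw [degree_eq_natDegree hP.ne_zero, hn]
  refine lt_of_le_of_lt degree_le_natDegree ?_
  have := natDegree_pow_le_of_le 2 hc'
  norm_cast
  omega

/-- For monic irreducible `P` of odd degree `2 * m + 1`, the sum of `(B/P)` over monic `B` of
degree `2 * m` equals `q ^ m`. -/
theorem sum_legendreSymbol_of_natDegree_eq {F : Type*} [Field F] [Fintype F]
    (hq : Odd (Fintype.card F)) {P : F[X]} (hP : P.Monic) (hirr : Irreducible P) {m : ℕ}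
    (hn : P.natDegree = 2 * m + 1) :
    ∑ᶠ B ∈ {B : F[X] | B.Monic ∧ B.natDegree = 2 * m}, legendreSymbol B P =
      (Fintype.card F : ℤ) ^ m := by
  have : Fact (Irreducible P) := ⟨hirr⟩
  have : Module.Finite F (AdjoinRoot P) := hP.finite_adjoinRoot
  have : Finite (AdjoinRoot P) := Module.finite_of_finite F
  let _ : Fintype (AdjoinRoot P) := Fintype.ofFinite _
  let _ : Fintype (degreeLT F (m + 1)) := Fintype.ofFinite _
  have hdeg : P.degree = (2 * m + 1 : ℕ) := by rw [degree_eq_natDegree hP.ne_zero, hn]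
  have hchar : ringChar F ≠ 2 := fun h => by
    have := FiniteField.even_card_of_char_two h
    exact (Nat.not_even_iff_odd.mpr hq) (Nat.even_iff.mpr this)
  have h2 : (2 : F) ≠ 0 := Ring.two_ne_zero hchar
  have hcharK : ringChar (AdjoinRoot P) ≠ 2 := by
    rwa [← Algebra.ringChar_eq F (AdjoinRoot P)]
  set e := reducedCoeff hP (2 * m) with he
  set U := (degreeLT F m).map (AdjoinRoot.mkₐ P).toLinearMap
  have hbij : Set.BijOn (AdjoinRoot.mk P) {B : F[X] | B.Monic ∧ B.natDegree = 2 * m}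
      ((Finset.univ.filter fun b => e b = 1 : Finset (AdjoinRoot P)) : Set (AdjoinRoot P)) := by
    have hlt (B : F[X]) (hB : B.Monic ∧ B.natDegree = 2 * m) : B.degree < P.degree := by
      rw [degree_eq_natDegree hB.1.ne_zero, hB.2, hdeg]; norm_cast; omega
    refine ⟨fun B hB => ?_, mk_injOn_degree_lt.mono hlt, fun x hx => ?_⟩
    · have h1 : B.coeff (2 * m) = 1 := by rw [← hB.2]; exact hB.1
      simp [he, reducedCoeff_mk hP _ (hlt B hB), h1]
    · obtain ⟨c, hc, rfl⟩ := exists_degree_lt_mk_eq hP x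
      have h1 : c.coeff (2 * m) = 1 := by simpa [he, reducedCoeff_mk hP _ hc] using hx
      rw [hdeg] at hc
      have hle : c.natDegree ≤ 2 * m :=
        natDegree_le_of_degree_le (Order.lt_succ_iff.mp (by exact_mod_cast hc))
      have heq : c.natDegree = 2 * m :=
        le_antisymm hle (le_natDegree_of_ne_zero (by simp [h1]))
      exact ⟨c, ⟨by rw [Monic, leadingCoeff, heq, h1], heq⟩, rfl⟩
  rw [finsum_mem_eq_of_bijOn _ hbij fun B _ => legendreSymbol_eq_quadraticChar B P,
    finsum_mem_coe_finset, sum_quadraticChar_fiber hcharK]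
  have hU : ∀ A ∈ U, ∀ B ∈ U, e (A * B) = 0 := by
    rintro A hA _ ⟨B, hB, rfl⟩
    have hB' : B.degree < m := mem_degreeLT.mp hB
    refine (reducedCoeff_orthogonal_iff hP hn (c := B) ?_).mpr ?_ A hA
    · rw [hdeg]; exact hB'.trans (by norm_cast; omega)
    · exact hB'.trans (by norm_cast; omega)
  have he0 : e ≠ 0 := fun h => by
    have h1 : e (AdjoinRoot.mk P (X ^ (2 * m))) = 1 := by
      rw [he, reducedCoeff_mk hP _ (by rw [degree_X_pow, hdeg]; norm_cast; omega)]
      simp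
    simp [h] at h1
  have hcount := card_mul_card_sq_eq_one h2 e U hU
  have hfiber := card_mul_card_fiber e he0 1
  have hsol := card_filter_mk hP (r := m + 1) (by omega)
    (fun C => (∀ A ∈ U, e (A * C) = 0) ∧ e (C ^ 2) = 1) (fun c => c.coeff m ^ 2 = 1)
    (fun c hc => by
      rw [reducedCoeff_orthogonal_iff hP hn hc]
      refine and_congr_right fun h => ?_
      rw [he, reducedCoeff_sq_of_degree_lt hP hn h])
  have hperp := card_filter_mk hP (r := m + 1) (by omega)
    (fun C => ∀ A ∈ U, e (A * C) = 0) (fun _ => True)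
    (fun c hc => by rw [reducedCoeff_orthogonal_iff hP hn hc, and_true])
  rw [Finset.filter_true, Finset.card_univ, card_degreeLT] at hperp
  have hcompl := Finset.card_filter_add_card_filter_not (s := Finset.univ)
    (fun C : AdjoinRoot P => ∀ A ∈ U, e (A * C) = 0)
  rw [hperp, Finset.card_univ] at hcompl
  rw [hsol, card_mul_card_coeff_sq_eq_one h2] at hcount
  have hq0 : (Fintype.card F : ℤ) ≠ 0 := by exact_mod_cast Fintype.card_ne_zero
  zify at hcount hfiber hcompl
  apply mul_left_cancel₀ hq0
  rw [mul_sub, hfiber, hcount, ← hcompl]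
  ring

theorem finite_setOf_natDegree_eq (F : Type*) [Field F] [Finite F] (n : ℕ) :
    {P : F[X] | P.natDegree = n}.Finite := by
  have hfin : (degreeLT F (n + 1) : Set F[X]).Finite :=
    Set.finite_coe_iff.mp (inferInstance : Finite (degreeLT F (n + 1)))
  refine hfin.subset fun P hP => ?_
  refine mem_degreeLT.mpr (lt_of_le_of_lt degree_le_natDegree ?_)
  rw [show P.natDegree = n from hP]
  exact_mod_cast Nat.lt_succ_self n

/-- For `q` odd and `n` odd, `S(n-1; n) = π_q(n) q^{(n-1)/2}`. -/
theorem doubleCharSum_top_odd (F : Type*) [Field F] [Fintype F]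
    (hq : Odd (Fintype.card F)) (n : ℕ) (hodd : Odd n) :
    doubleCharSum F (n - 1) n =
      (primeCount F n : ℤ) * (Fintype.card F : ℤ) ^ ((n - 1) / 2) := by
  obtain ⟨m, rfl⟩ := hodd
  have hfin : {P : F[X] | P.Monic ∧ Irreducible P ∧ P.natDegree = 2 * m + 1}.Finite :=
    (finite_setOf_natDegree_eq F (2 * m + 1)).subset fun P hP => hP.2.2
  rw [doubleCharSum, primeCount, Nat.add_sub_cancel, Nat.mul_div_cancel_left m two_pos,
    finsum_mem_congr rfl fun P hP => sum_legendreSymbol_of_natDegree_eq hq hP.1 hP.2.1 hP.2.2,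
    finsum_mem_eq_finite_toFinset_sum _ hfin, Set.ncard_eq_toFinset_card _ hfin]
  simp
end

section
/- Let q be odd and B a monic polynomial of positive degree that is not a perfect square. Then |Σ_{P monic irreducible, deg P = n} (B/P)| ≪ (deg B / n)·q^{n/2}, with an absolute implied constant. -/
open Polynomial
open scoped Classical

theorem X_sub_C_pow_dvd_of_hasseDeriv {R : Type*} [CommRing R] {p : R[X]} {x : R} {l : ℕ}
    (h : ∀ k < l, (hasseDeriv k p).eval x = 0) : (X - C x) ^ l ∣ p := by
  have h1 : X ^ l ∣ taylor x p := by
    rw [X_pow_dvd_iff]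
    intro k hk
    rw [taylor_coeff, h k hk]
  obtain ⟨u, hu⟩ := h1
  refine ⟨taylor (-x) u, ?_⟩
  have := congrArg (taylor (-x)) hu
  simpa [taylor_taylor, taylor_mul, taylor_pow, sub_eq_add_neg] using this

theorem exists_hasseDeriv_pow_factor {R : Type*} [CommRing R] (f : R[X]) (N i : ℕ) (hi : i ≤ N) :
    ∃ w : R[X], hasseDeriv i (f ^ N) = f ^ (N - i) * w ∧ w.natDegree ≤ i * f.natDegree := by
  induction N generalizing i with
  | zero =>
    obtain rfl : i = 0 := by omega
    exact ⟨1, by simp⟩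
  | succ N ih =>
    rw [pow_succ', hasseDeriv_mul]
    have key : ∀ ab ∈ Finset.HasAntidiagonal.antidiagonal i, ∃ w : R[X],
        hasseDeriv ab.1 f * hasseDeriv ab.2 (f ^ N) = f ^ (N + 1 - i) * w ∧
          w.natDegree ≤ i * f.natDegree := by
      rintro ⟨a, b⟩ hab
      rw [Finset.HasAntidiagonal.mem_antidiagonal] at hab
      dsimp only at hab ⊢
      rcases Nat.eq_zero_or_pos a with rfl | ha
      · obtain rfl : b = i := by omega
        rcases Nat.lt_or_ge N b with hb | hb
        · obtain rfl : b = N + 1 := by omega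
          refine ⟨f * hasseDeriv (N + 1) (f ^ N), by simp, ?_⟩
          refine natDegree_mul_le.trans ?_
          have h1 := natDegree_hasseDeriv_le (f ^ N) (N + 1)
          have h2 : (f ^ N).natDegree ≤ N * f.natDegree := natDegree_pow_le
          nlinarith [Nat.sub_le (f ^ N).natDegree (N + 1)]
        · obtain ⟨w, hw, hd⟩ := ih b hb
          refine ⟨w, ?_, hd⟩
          rw [hasseDeriv_zero', hw, Nat.succ_sub hb, pow_succ']
          ring
      · obtain ⟨w, hw, hd⟩ := ih b (by omega)
        refine ⟨hasseDeriv a f * (f ^ (a - 1) * w), ?_, ?_⟩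
        · rw [hw, show N - b = (N + 1 - i) + (a - 1) by omega, pow_add]
          ring
        · refine natDegree_mul_le.trans ?_
          have h1 := natDegree_hasseDeriv_le f a
          have h2 : (f ^ (a - 1)).natDegree ≤ (a - 1) * f.natDegree := natDegree_pow_le
          have h3 := natDegree_mul_le (p := f ^ (a - 1)) (q := w)
          obtain ⟨c, rfl⟩ : ∃ c, a = c + 1 := ⟨a - 1, by omega⟩
          have h4 := Nat.sub_le f.natDegree (c + 1)
          rw [← hab]
          simp only [Nat.add_sub_cancel] at *
          nlinarith
    choose! w hw hd using key
    refine ⟨∑ ab ∈ Finset.HasAntidiagonal.antidiagonal i, w ab, ?_, ?_⟩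
    · rw [Finset.mul_sum]
      exact Finset.sum_congr rfl hw
    · exact natDegree_sum_le_of_forall_le _ _ hd

theorem exists_linear_hasseDeriv_pow_mul {R : Type*} [CommRing R] (f : R[X]) {N k : ℕ}
    (hk : k ≤ N) : ∃ A : R[X] →ₗ[R] R[X], ∀ u : R[X],
      hasseDeriv k (f ^ N * u) = f ^ (N - k) * A u ∧
        (A u).natDegree ≤ u.natDegree + k * f.natDegree := by
  choose! w hw hd using fun i hi => exists_hasseDeriv_pow_factor f N i hi
  refine ⟨∑ ab ∈ Finset.HasAntidiagonal.antidiagonal k,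
    (LinearMap.mulLeft R (f ^ ab.2 * w ab.1)).comp (hasseDeriv ab.2), fun u => ⟨?_, ?_⟩⟩
  · rw [hasseDeriv_mul, LinearMap.sum_apply, Finset.mul_sum]
    refine Finset.sum_congr rfl ?_
    rintro ⟨a, b⟩ hab
    rw [Finset.HasAntidiagonal.mem_antidiagonal] at hab
    dsimp only at hab ⊢
    rw [hw a (by omega), show N - a = (N - k) + b by omega, pow_add]
    simp only [LinearMap.comp_apply, LinearMap.mulLeft_apply]
    ring
  · rw [LinearMap.sum_apply]
    refine natDegree_sum_le_of_forall_le _ _ ?_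
    rintro ⟨a, b⟩ hab
    rw [Finset.HasAntidiagonal.mem_antidiagonal] at hab
    simp only [LinearMap.comp_apply, LinearMap.mulLeft_apply]
    have h1 := hd a (by omega)
    have h2 : (f ^ b).natDegree ≤ b * f.natDegree := natDegree_pow_le
    have h3 := natDegree_mul_le (p := f ^ b) (q := w a)
    have h4 := natDegree_mul_le (p := f ^ b * w a) (q := hasseDeriv b u)
    have h5 := natDegree_hasseDeriv_le u b
    have h6 := Nat.sub_le u.natDegree b
    rw [← hab]
    nlinarith

theorem eq_sq_of_sq_mul_eq_C_mul_sq {K : Type*} [Field K] {f r s : K[X]} {c : K}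
    (hf : f.Monic) (hr : r ≠ 0) (h : r ^ 2 * f = C c * s ^ 2) : ∃ A : K[X], f = A ^ 2 := by
  have hr' : r.leadingCoeff ≠ 0 := leadingCoeff_ne_zero.mpr hr
  have hl : r.leadingCoeff ^ 2 = c * s.leadingCoeff ^ 2 := by
    have := congrArg leadingCoeff h
    simpa [leadingCoeff_mul, leadingCoeff_pow, hf.leadingCoeff] using this
  have hs : s.leadingCoeff ≠ 0 := by
    intro h0
    rw [h0] at hl
    simp [hr] at hl
  have hc : c = (r.leadingCoeff / s.leadingCoeff) ^ 2 := by
    field_simp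
    exact hl.symm
  have h2 : r ^ 2 * f = (C (r.leadingCoeff / s.leadingCoeff) * s) ^ 2 := by
    rw [h, mul_pow, ← C_pow, ← hc]
  obtain ⟨t, ht⟩ : r ∣ C (r.leadingCoeff / s.leadingCoeff) * s :=
    (IsIntegrallyClosed.pow_dvd_pow_iff two_ne_zero).mp ⟨f, h2.symm⟩
  refine ⟨t, mul_left_cancel₀ (pow_ne_zero 2 hr) ?_⟩
  rw [h2, ht, mul_pow]

section FiniteField

variable {K : Type*} [Field K] [Fintype K]

theorem X_pow_card_dvd_pow_card_sub_C (f : K[X]) :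
    X ^ Fintype.card K ∣ f ^ Fintype.card K - C (f.eval 0) := by
  have h : X ∣ f - C (f.eval 0) := by
    rw [X_dvd_iff, coeff_sub, coeff_C_zero, coeff_zero_eq_eval_zero, sub_self]
  obtain ⟨u, hu⟩ := h
  have := congrArg (expand K (Fintype.card K)) hu
  rw [map_sub, expand_C, map_mul, expand_X, FiniteField.expand_card] at this
  exact ⟨_, this⟩

theorem eq_zero_of_X_pow_card_dvd {f u v : K[X]} {b d : ℕ} (hq : Fintype.card K = 2 * b + 1)
    (hf : f.Monic) (hsq : ¬ ∃ A : K[X], f = A ^ 2) (h0 : f.eval 0 ≠ 0)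
    (hd : 2 * d + f.natDegree < Fintype.card K) (hu : u.natDegree ≤ d) (hv : v.natDegree ≤ d)
    (h : X ^ Fintype.card K ∣ u + f ^ b * v) : u = 0 ∧ v = 0 := by
  have h1 : X ^ Fintype.card K ∣ u ^ 2 * f - C (f.eval 0) * v ^ 2 := by
    have h2 : u ^ 2 * f - C (f.eval 0) * v ^ 2 = (u + f ^ b * v) * (f * (u - f ^ b * v)) +
        (f ^ Fintype.card K - C (f.eval 0)) * v ^ 2 := by
      rw [hq]; ring
    rw [h2]
    exact dvd_add (h.mul_right _) ((X_pow_card_dvd_pow_card_sub_C f).mul_right _)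
  have h3 : u ^ 2 * f - C (f.eval 0) * v ^ 2 = 0 := by
    by_contra hne
    have h4 := natDegree_le_of_dvd h1 hne
    rw [natDegree_X_pow] at h4
    have h5 : (u ^ 2 * f).natDegree ≤ 2 * d + f.natDegree :=
      natDegree_mul_le.trans (by
        have := natDegree_pow_le (p := u) (n := 2)
        omega)
    have h6 : (C (f.eval 0) * v ^ 2).natDegree ≤ 2 * d :=
      (natDegree_C_mul_le _ _).trans (by
        have := natDegree_pow_le (p := v) (n := 2)
        omega)
    have h7 := natDegree_sub_le (u ^ 2 * f) (C (f.eval 0) * v ^ 2)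
    omega
  rw [sub_eq_zero] at h3
  have hu0 : u = 0 := by
    by_contra hne
    exact hsq (eq_sq_of_sq_mul_eq_C_mul_sq hf hne h3)
  refine ⟨hu0, ?_⟩
  simpa [hu0, h0] using h3

theorem eq_zero_of_sum_mul_X_pow_eq_zero {f : K[X]} {b d : ℕ} (hq : Fintype.card K = 2 * b + 1)
    (hf : f.Monic) (hsq : ¬ ∃ A : K[X], f = A ^ 2) (h0 : f.eval 0 ≠ 0)
    (hd : 2 * d + f.natDegree < Fintype.card K) (J : ℕ) (u v : ℕ → K[X])
    (hu : ∀ j, (u j).natDegree ≤ d) (hv : ∀ j, (v j).natDegree ≤ d)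
    (h : ∑ j ∈ Finset.range J, (u j + f ^ b * v j) * X ^ (j * Fintype.card K) = 0) :
    ∀ j < J, u j = 0 ∧ v j = 0 := by
  induction J generalizing u v with
  | zero => simp
  | succ J ih =>
    rw [Finset.sum_range_succ'] at h
    have hfac : ∑ j ∈ Finset.range J,
        (u (j + 1) + f ^ b * v (j + 1)) * X ^ ((j + 1) * Fintype.card K) =
        X ^ Fintype.card K * ∑ j ∈ Finset.range J,
          (u (j + 1) + f ^ b * v (j + 1)) * X ^ (j * Fintype.card K) := by
      rw [Finset.mul_sum]
      refine Finset.sum_congr rfl fun j _ => ?_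
      ring
    rw [hfac, zero_mul, pow_zero, mul_one] at h
    have h00 : u 0 = 0 ∧ v 0 = 0 := by
      refine eq_zero_of_X_pow_card_dvd hq hf hsq h0 hd (hu 0) (hv 0) ?_
      rw [eq_neg_of_add_eq_zero_right h]
      exact (dvd_mul_right _ _).neg_right
    rw [h00.1, h00.2, mul_zero, add_zero, add_zero] at h
    have h2 := (mul_eq_zero.mp h).resolve_left (pow_ne_zero _ X_ne_zero)
    have h3 := ih (fun j => u (j + 1)) (fun j => v (j + 1)) (fun j => hu _) (fun j => hv _) h2
    rintro (_ | j) hj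
    · exact h00
    · exact h3 j (by omega)

theorem X_sub_C_pow_dvd_X_pow_card_pow_sub (x : K) {l : ℕ} (hl : l ≤ Fintype.card K) (j : ℕ) :
    (X - C x) ^ l ∣ X ^ (j * Fintype.card K) - C (x ^ j) := by
  have h1 : (X - C x) ^ Fintype.card K = X ^ Fintype.card K - C x := by
    rw [← FiniteField.expand_card, map_sub, expand_X, expand_C]
  rw [mul_comm, pow_mul, C_pow]
  refine ((pow_dvd_pow _ hl).trans (dvd_of_eq h1)).trans (sub_dvd_pow_sub_pow _ _ j)

theorem exists_stepanov_coeffs (f : K[X]) (a : K) {b d l J : ℕ} (hl : l ≤ Fintype.card K)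
    (hdim : l * (d + 1 + l * f.natDegree + J) < 2 * J * (d + 1)) :
    ∃ u v : ℕ → K[X], (∀ j, (u j).natDegree ≤ d) ∧ (∀ j, (v j).natDegree ≤ d) ∧
      (∃ j < J, ¬ (u j = 0 ∧ v j = 0)) ∧
      ∀ x : K, f.eval x ^ b = a → (X - C x) ^ l ∣
        f ^ l * ∑ j ∈ Finset.range J, (u j + f ^ b * v j) * X ^ (j * Fintype.card K) := by
  choose! A hA hAd using fun k (hk : k ≤ l) => exists_linear_hasseDeriv_pow_mul f hk
  choose! B hB hBd using fun k (hk : k ≤ l) =>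
    exists_linear_hasseDeriv_pow_mul f (hk.trans (Nat.le_add_right l b))
  set M := d + 1 + l * f.natDegree + J with hM
  let V := degreeLT K (d + 1)
  let Q (k : ℕ) : (Fin J → V × V) →ₗ[K] K[X] := ∑ j : Fin J,
    LinearMap.mulLeft K (X ^ (j : ℕ)) ∘ₗ
      (A k ∘ₗ V.subtype ∘ₗ LinearMap.fst K V V + a • (B k ∘ₗ V.subtype ∘ₗ LinearMap.snd K V V)) ∘ₗ
        LinearMap.proj j
  let Φ : (Fin J → V × V) →ₗ[K] (Fin l → Fin M → K) :=
    LinearMap.pi fun k => LinearMap.pi fun i => lcoeff K (i : ℕ) ∘ₗ Q k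
  have hfin : Module.finrank K V = d + 1 := by
    rw [(degreeLTEquiv K (d + 1)).finrank_eq, Module.finrank_fin_fun]
  have : Module.Finite K V := Module.Finite.equiv (degreeLTEquiv K (d + 1)).symm
  have hker : LinearMap.ker Φ ≠ ⊥ := by
    apply LinearMap.ker_ne_bot_of_finrank_lt
    simp only [Module.finrank_pi_fintype, Module.finrank_prod, hfin, Module.finrank_self,
      Finset.sum_const, Finset.card_univ, Fintype.card_fin, smul_eq_mul, mul_one]
    linarith
  obtain ⟨w, hw, hw0⟩ := (Submodule.ne_bot_iff _).mp hker
  have hVd : ∀ p : V, (p : K[X]).natDegree ≤ d := fun p => by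
    rw [natDegree_le_iff_coeff_eq_zero]
    intro N hN
    exact degree_lt_iff_coeff_zero _ _ |>.mp (mem_degreeLT.mp p.2) N hN
  have hQ : ∀ k, Q k w = ∑ j : Fin J,
      X ^ (j : ℕ) * (A k ((w j).1 : K[X]) + a • B k ((w j).2 : K[X])) := fun k => by
    simp [Q]
  have hQ0 : ∀ k < l, Q k w = 0 := by
    intro k hk
    have hdeg : (Q k w).natDegree ≤ d + l * f.natDegree + J := by
      rw [hQ]
      refine natDegree_sum_le_of_forall_le _ _ fun j _ => ?_
      have h1 := (hAd k hk.le (w j).1).trans (Nat.add_le_add_right (hVd _) _)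
      have h2 := (hBd k hk.le (w j).2).trans (Nat.add_le_add_right (hVd _) _)
      have h3 : (A k ((w j).1 : K[X]) + a • B k ((w j).2 : K[X])).natDegree ≤
          d + k * f.natDegree :=
        natDegree_add_le_of_degree_le h1 ((natDegree_smul_le _ _).trans h2)
      have h4 : (X ^ (j : ℕ) : K[X]).natDegree ≤ J := (natDegree_X_pow_le _).trans j.2.le
      have h5 := Nat.mul_le_mul_right f.natDegree hk.le
      exact natDegree_mul_le.trans (by omega)
    ext n
    rw [coeff_zero]
    rcases Nat.lt_or_ge n M with hn | hn
    · have := congrFun (congrFun (LinearMap.mem_ker.mp hw) ⟨k, hk⟩) ⟨n, hn⟩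
      simpa [Φ] using this
    · exact coeff_eq_zero_of_natDegree_lt (by omega)
  let u (j : ℕ) : K[X] := if h : j < J then (w ⟨j, h⟩).1 else 0
  let v (j : ℕ) : K[X] := if h : j < J then (w ⟨j, h⟩).2 else 0
  have hu (j : Fin J) : u j = (w j).1 := by simp [u]
  have hv (j : Fin J) : v j = (w j).2 := by simp [v]
  refine ⟨u, v, fun j => ?_, fun j => ?_, ?_, fun x hx => ?_⟩
  · by_cases h : j < J
    · simpa [u, h] using hVd _
    · simp [u, h]
  · by_cases h : j < J
    · simpa [v, h] using hVd _
    · simp [v, h]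
  · by_contra! hall
    refine hw0 (funext fun j => ?_)
    have h1 := hall j j.2
    rw [hu, hv] at h1
    exact Prod.ext (Subtype.ext h1.1) (Subtype.ext h1.2)
  · have hR : (X - C x) ^ l ∣
        f ^ l * ∑ j ∈ Finset.range J, (u j + f ^ b * v j) * C (x ^ j) := by
      refine X_sub_C_pow_dvd_of_hasseDeriv fun k hk => ?_
      have h1 : f ^ l * ∑ j ∈ Finset.range J, (u j + f ^ b * v j) * C (x ^ j) =
          ∑ j : Fin J, x ^ (j : ℕ) • (f ^ l * u j + f ^ (l + b) * v j) := by
        rw [Finset.sum_range, Finset.mul_sum]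
        refine Finset.sum_congr rfl fun j _ => ?_
        rw [smul_eq_C_mul]
        ring
      have h2 : (hasseDeriv k (∑ j : Fin J, x ^ (j : ℕ) • (f ^ l * u j + f ^ (l + b) * v j))).eval x
          = f.eval x ^ (l - k) * (Q k w).eval x := by
        rw [hQ, map_sum, eval_finsetSum, eval_finsetSum, Finset.mul_sum]
        refine Finset.sum_congr rfl fun j _ => ?_
        rw [map_smul, map_add, hA k hk.le, hB k hk.le, show l + b - k = (l - k) + b by omega,
          pow_add, hu, hv]
        simp only [eval_smul, eval_add, eval_mul, eval_pow, eval_X, hx, smul_eq_mul]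
        ring
      rw [h1, h2, hQ0 k hk, eval_zero, mul_zero]
    have hdiff : (X - C x) ^ l ∣ f ^ l * ∑ j ∈ Finset.range J,
        (u j + f ^ b * v j) * (X ^ (j * Fintype.card K) - C (x ^ j)) :=
      (Finset.dvd_sum fun j _ =>
        (X_sub_C_pow_dvd_X_pow_card_pow_sub x hl j).mul_left _).mul_left _
    have := dvd_add hdiff hR
    rwa [← mul_add, ← Finset.sum_add_distrib, Finset.sum_congr rfl fun j _ => by
      rw [← mul_add, sub_add_cancel]] at this

/-- Stepanov's bound for the number of `x` with `f(x)^((q-1)/2) = a`. -/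
theorem card_mul_le_of_stepanov {f : K[X]} (a : K) {b d l J : ℕ}
    (hq : Fintype.card K = 2 * b + 1) (hf : f.Monic) (hsq : ¬ ∃ A : K[X], f = A ^ 2)
    (h0 : f.eval 0 ≠ 0) (hd : 2 * d + f.natDegree < Fintype.card K) (hl : l ≤ Fintype.card K)
    (hdim : l * (d + 1 + l * f.natDegree + J) < 2 * J * (d + 1)) :
    l * (Finset.univ.filter fun x : K => f.eval x ^ b = a).card ≤
      l * f.natDegree + (d + b * f.natDegree) + J * Fintype.card K := by
  obtain ⟨u, v, hu, hv, ⟨j, hj, hne⟩, hdvd⟩ := exists_stepanov_coeffs f a (b := b) hl hdim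
  set S := Finset.univ.filter fun x : K => f.eval x ^ b = a with hS
  set p := f ^ l * ∑ j ∈ Finset.range J, (u j + f ^ b * v j) * X ^ (j * Fintype.card K) with hp
  have hp0 : p ≠ 0 := mul_ne_zero (pow_ne_zero _ hf.ne_zero) fun h =>
    hne (eq_zero_of_sum_mul_X_pow_eq_zero hq hf hsq h0 hd J u v hu hv h j hj)
  have h1 : ∏ x ∈ S, (X - C x) ^ l ∣ p := by
    refine Finset.prod_dvd_of_coprime (fun x _ y _ hxy => ?_) fun x hx => ?_
    · exact (pairwise_coprime_X_sub_C Function.injective_id hxy).pow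
    · exact hdvd x (Finset.mem_filter.mp hx).2
  have h2 := natDegree_le_of_dvd h1 hp0
  rw [Finset.prod_pow, natDegree_pow, natDegree_prod_of_monic _ _ fun x _ => monic_X_sub_C x] at h2
  simp only [natDegree_X_sub_C, Finset.sum_const, smul_eq_mul, mul_one] at h2
  refine h2.trans (natDegree_mul_le.trans ?_)
  have h3 : (f ^ l).natDegree ≤ l * f.natDegree := natDegree_pow_le
  have h4 : (∑ j ∈ Finset.range J, (u j + f ^ b * v j) * X ^ (j * Fintype.card K)).natDegree ≤
      (d + b * f.natDegree) + J * Fintype.card K := by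
    refine natDegree_sum_le_of_forall_le _ _ fun j hj => natDegree_mul_le.trans ?_
    have h5 : (f ^ b * v j).natDegree ≤ d + b * f.natDegree := by
      have h6 : (f ^ b).natDegree ≤ b * f.natDegree := natDegree_pow_le
      exact natDegree_mul_le.trans (by have := hv j; omega)
    have h7 : (u j + f ^ b * v j).natDegree ≤ d + b * f.natDegree :=
      natDegree_add_le_of_degree_le ((hu j).trans (Nat.le_add_right _ _)) h5
    rw [natDegree_X_pow]
    exact Nat.add_le_add h7 (Nat.mul_le_mul_right _ (Finset.mem_range.mp hj).le)
  omega

end FiniteField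

section CharacterSum

variable {K : Type*} [Field K] [Fintype K]

theorem card_le_half_add_of_eval_zero_ne_zero {f : K[X]} (a : K) {b : ℕ}
    (hq : Fintype.card K = 2 * b + 1) (hf : f.Monic) (hm : 1 ≤ f.natDegree)
    (hsq : ¬ ∃ A : K[X], f = A ^ 2) (h0 : f.eval 0 ≠ 0)
    (hlarge : 16 * f.natDegree ≤ Nat.sqrt (Fintype.card K)) :
    ((Finset.univ.filter fun x : K => f.eval x ^ b = a).card : ℝ) ≤
      Fintype.card K / 2 + 11 * f.natDegree * √(Fintype.card K) := by
  set q := Fintype.card K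
  set m := f.natDegree
  set s := Nat.sqrt q
  have hsq_le : s * s ≤ q := Nat.sqrt_le q
  have hlt : q < (s + 1) * (s + 1) := Nat.lt_succ_sqrt q
  have hs16 : 16 ≤ s := by omega
  have h16s : 16 * s ≤ q := (Nat.mul_le_mul_right s hs16).trans hsq_le
  obtain ⟨d, hd1, hd2⟩ : ∃ d, 2 * d + m < q ∧ q ≤ 2 * (d + 1) + m :=
    ⟨(q - 1 - m) / 2, by omega, by omega⟩
  have hdim : 2 * s * (d + 1 + 2 * s * m + (s + 8 * m)) < 2 * (s + 8 * m) * (d + 1) := by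
    have e1 : m * (s * s) ≤ m * q := Nat.mul_le_mul_left m hsq_le
    have e2 : m * q ≤ m * (2 * (d + 1) + m) := Nat.mul_le_mul_left m hd2
    have e3 : 1 * q ≤ m * q := Nat.mul_le_mul_right q hm
    have e4 : m * (16 * s + 8 * m + 1) ≤ m * (2 * q) := Nat.mul_le_mul_left m (by omega)
    nlinarith
  have key := card_mul_le_of_stepanov a hq hf hsq h0 hd1 (l := 2 * s) (by omega) hdim
  set N := (Finset.univ.filter fun x : K => f.eval x ^ b = a).card
  have hb : b * m ≤ q * m := Nat.mul_le_mul_right m (by omega)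
  have hmq : 1 * q ≤ m * q := Nat.mul_le_mul_right q hm
  have key2 : 2 * s * N ≤ 2 * s * m + s * q + 10 * (m * q) := by
    have : d ≤ q := by omega
    nlinarith
  have key3 : 2 * (s : ℝ) * N ≤ 2 * s * m + s * q + 10 * (m * q) := by exact_mod_cast key2
  have hspos : (0 : ℝ) < s := by exact_mod_cast (by omega : 0 < s)
  have hr : √(q : ℝ) ≤ 2 * s := by
    rw [Real.sqrt_le_left (by positivity)]
    have : q ≤ (2 * s) ^ 2 := by nlinarith
    exact_mod_cast this
  have hr1 : 1 ≤ √(q : ℝ) := Real.one_le_sqrt.mpr (by exact_mod_cast (by omega : 1 ≤ q))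
  have hrr : √(q : ℝ) * √(q : ℝ) = q := Real.mul_self_sqrt (Nat.cast_nonneg q)
  have hm0 : (0 : ℝ) ≤ m := Nat.cast_nonneg m
  have h1 : (m : ℝ) * q ≤ m * √q * (2 * s) := by
    rw [mul_assoc]
    refine mul_le_mul_of_nonneg_left ?_ hm0
    nlinarith
  have h2 : (m : ℝ) * s ≤ m * √q * s := by
    have : (m : ℝ) * 1 ≤ m * √q := mul_le_mul_of_nonneg_left hr1 hm0
    nlinarith
  have h3 : (2 * (s : ℝ)) * N ≤ (2 * s) * (q / 2 + 11 * m * √q) := by nlinarith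
  exact le_of_mul_le_mul_left h3 (by positivity)

theorem abs_sum_quadraticChar_le_of_eval_zero_ne_zero {f : K[X]} (hodd : Odd (Fintype.card K))
    (hf : f.Monic) (hm : 1 ≤ f.natDegree) (hsq : ¬ ∃ A : K[X], f = A ^ 2) (h0 : f.eval 0 ≠ 0)
    (hlarge : 16 * f.natDegree ≤ Nat.sqrt (Fintype.card K)) :
    |((∑ x : K, quadraticChar K (f.eval x) : ℤ) : ℝ)| ≤
      23 * f.natDegree * √(Fintype.card K) := by
  obtain ⟨b, hb⟩ := hodd
  have hchar : ringChar K ≠ 2 := by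
    rw [Ne, FiniteField.even_card_iff_char_two]
    omega
  have hpow (y : K) : (quadraticChar K y : K) = y ^ b := by
    rw [quadraticChar_eq_pow_of_char_ne_two' hchar, hb]
    congr 1
    omega
  set S : ℤ → Finset K := fun i => Finset.univ.filter fun x => quadraticChar K (f.eval x) = i
  have hS (i : ℤ) : ((S i).card : ℝ) ≤
      Fintype.card K / 2 + 11 * f.natDegree * √(Fintype.card K) := by
    refine le_trans ?_ (card_le_half_add_of_eval_zero_ne_zero (i : K) hb hf hm hsq h0 hlarge)
    refine Nat.cast_le.mpr (Finset.card_le_card fun x hx => ?_)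
    simp only [S, Finset.mem_filter, Finset.mem_univ, true_and] at hx ⊢
    rw [← hpow, hx]
  have hS0 : (S 0).card ≤ f.natDegree := by
    refine le_trans (Finset.card_le_card (t := f.roots.toFinset) fun x hx => ?_)
      ((Multiset.toFinset_card_le _).trans (card_roots' f))
    simp only [S, Finset.mem_filter, Finset.mem_univ, true_and, quadraticChar_eq_zero_iff] at hx
    simpa [hf.ne_zero] using hx
  have htri (x : K) : quadraticChar K (f.eval x) = 0 ∨ quadraticChar K (f.eval x) = 1 ∨
      quadraticChar K (f.eval x) = -1 := by
    by_cases h : f.eval x = 0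
    · simp [h]
    · exact Or.inr (quadraticChar_dichotomy h)
  have hsum : ∑ x : K, quadraticChar K (f.eval x) = (S 1).card - (S (-1)).card := by
    simp only [S, Finset.card_filter, Nat.cast_sum, ← Finset.sum_sub_distrib]
    refine Finset.sum_congr rfl fun x _ => ?_
    rcases htri x with h | h | h <;> simp [h]
  have hcard : Fintype.card K = (S 0).card + (S 1).card + (S (-1)).card := by
    simp only [S, Finset.card_filter, ← Finset.sum_add_distrib]
    rw [← Finset.card_univ, Finset.card_eq_sum_ones]
    refine Finset.sum_congr rfl fun x _ => ?_
    rcases htri x with h | h | h <;> simp [h]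
  have hcard' : (Fintype.card K : ℝ) = (S 0).card + (S 1).card + (S (-1)).card := by
    exact_mod_cast hcard
  have hS0' : ((S 0).card : ℝ) ≤ f.natDegree := by exact_mod_cast hS0
  have hr1 : 1 ≤ √(Fintype.card K : ℝ) :=
    Real.one_le_sqrt.mpr (by exact_mod_cast Fintype.card_pos)
  have h1 := hS 1
  have h2 := hS (-1)
  have h3 : (f.natDegree : ℝ) ≤ f.natDegree * √(Fintype.card K) :=
    le_mul_of_one_le_right (Nat.cast_nonneg _) hr1
  rw [hsum]
  push_cast
  rw [abs_le]
  constructor <;> linarith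

/-- The Weil bound for quadratic character sums, with an explicit constant. -/
theorem abs_sum_quadraticChar_le {f : K[X]} (hodd : Odd (Fintype.card K))
    (hf : f.Monic) (hm : 1 ≤ f.natDegree) (hsq : ¬ ∃ A : K[X], f = A ^ 2) :
    |((∑ x : K, quadraticChar K (f.eval x) : ℤ) : ℝ)| ≤
      23 * f.natDegree * √(Fintype.card K) := by
  rcases Nat.lt_or_ge (Nat.sqrt (Fintype.card K)) (16 * f.natDegree) with hsmall | hlarge
  · have h1 : |∑ x : K, quadraticChar K (f.eval x)| ≤ Fintype.card K := by
      refine (Finset.abs_sum_le_sum_abs _ _).trans ?_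
      rw [← Finset.card_univ, Finset.card_eq_sum_ones, Nat.cast_sum]
      refine Finset.sum_le_sum fun x _ => ?_
      by_cases h : f.eval x = 0
      · simp [h]
      · rcases quadraticChar_dichotomy h with h | h <;> simp [h]
    have h2 : |((∑ x : K, quadraticChar K (f.eval x) : ℤ) : ℝ)| ≤ Fintype.card K := by
      exact_mod_cast h1
    have h3 : √(Fintype.card K : ℝ) ≤ 16 * f.natDegree := by
      rw [Real.sqrt_le_left (by positivity)]
      exact_mod_cast (Nat.sqrt_lt'.mp hsmall).le
    have h4 := Real.mul_self_sqrt (Nat.cast_nonneg (α := ℝ) (Fintype.card K))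
    have h5 := Real.sqrt_nonneg (Fintype.card K : ℝ)
    nlinarith
  · obtain ⟨y, hy⟩ : ∃ y : K, f.eval y ≠ 0 := by
      by_contra! hall
      have h1 : Fintype.card K ≤ f.natDegree := by
        rw [← Finset.card_univ]
        exact card_le_degree_of_subset_roots (p := f) fun x _ => by
          simpa [hf.ne_zero] using hall x
      have := Nat.sqrt_le_self (Fintype.card K)
      omega
    have key := abs_sum_quadraticChar_le_of_eval_zero_ne_zero (f := taylor y f) hodd
      (by rw [Monic, leadingCoeff_taylor]; exact hf) (by rwa [natDegree_taylor])
      (fun ⟨A, hA⟩ => hsq ⟨taylor (-y) A, by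
        have := congrArg (taylor (-y)) hA
        simpa [taylor_taylor, taylor_pow] using this⟩)
      (by simpa [taylor_eval] using hy) (by rwa [natDegree_taylor])
    rw [natDegree_taylor] at key
    simp only [taylor_eval] at key
    have hsum := Equiv.sum_comp (Equiv.addRight y) fun x => quadraticChar K (f.eval x)
    rw [Equiv.coe_addRight] at hsum
    rwa [hsum] at key

end CharacterSum

section Extension

variable {F K : Type*} [Field F] [Field K] [Algebra F K]

theorem exists_eq_sq_of_map_eq_sq [IsGalois F K] [FiniteDimensional F K] (hchar : (2 : K) ≠ 0)
    {B : F[X]} (hB : B.Monic) {A : K[X]} (h : B.map (algebraMap F K) = A ^ 2) :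
    ∃ A' : F[X], B = A' ^ 2 := by
  have hlc : A.leadingCoeff * A.leadingCoeff = 1 := by
    have := congrArg leadingCoeff h
    rwa [(hB.map _).leadingCoeff, leadingCoeff_pow, sq, eq_comm] at this
  set A₀ := C A.leadingCoeff * A with hA₀
  have hmonic : A₀.Monic := by
    rw [Monic, leadingCoeff_mul, leadingCoeff_C, hlc]
  have hsq : B.map (algebraMap F K) = A₀ ^ 2 := by
    rw [h, hA₀, mul_pow, ← C_pow, sq A.leadingCoeff, hlc, C_1, one_mul]
  have hfix (σ : Gal(K/F)) : A₀.map (σ : K →+* K) = A₀ := by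
    have h1 : (A₀.map (σ : K →+* K)) ^ 2 = A₀ ^ 2 := by
      rw [← Polynomial.map_pow, ← hsq, map_map]
      congr 1
      ext x
      simp
    rcases sq_eq_sq_iff_eq_or_eq_neg.mp h1 with h2 | h2
    · exact h2
    · exfalso
      have h3 := congrArg leadingCoeff h2
      rw [(hmonic.map _).leadingCoeff, leadingCoeff_neg, hmonic.leadingCoeff] at h3
      apply hchar
      linear_combination h3
  have hlift : A₀ ∈ lifts (algebraMap F K) := by
    rw [lifts_iff_coeff_lifts]
    intro n
    rw [IsGalois.mem_range_algebraMap_iff_fixed]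
    intro σ
    have := congrArg (fun p => coeff p n) (hfix σ)
    simpa using this
  obtain ⟨A', hA'⟩ := (mem_lifts _).mp hlift
  refine ⟨A', map_injective _ (algebraMap F K).injective ?_⟩
  rw [hsq, ← hA', Polynomial.map_pow]

theorem exists_aeval_eq_of_natDegree_minpoly_eq_finrank [FiniteDimensional F K] {x : K}
    (hx : (minpoly F x).natDegree = Module.finrank F K) (y : K) : ∃ p : F[X], aeval x p = y := by
  have h := (Field.primitive_element_iff_minpoly_natDegree_eq F x).mpr hx
  have h1 := IntermediateField.adjoin_simple_toSubalgebra_of_isAlgebraic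
    (Algebra.IsAlgebraic.isAlgebraic (R := F) x)
  rw [h, Algebra.adjoin_singleton_eq_range_aeval] at h1
  have : y ∈ (aeval x : F[X] →ₐ[F] K).range := h1 ▸ trivial
  exact this

theorem legendreSymbol_minpoly_eq_quadraticChar [Fintype K] [FiniteDimensional F K] {x : K}
    (hx : (minpoly F x).natDegree = Module.finrank F K) (B : F[X]) :
    legendreSymbol B (minpoly F x) = quadraticChar K (aeval x B) := by
  rw [legendreSymbol]
  simp only [minpoly.dvd_iff, map_sub, map_pow, sub_eq_zero]
  split_ifs with h0 h1
  · simp [h0]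
  · obtain ⟨p, hp⟩ := h1
    rw [eq_comm, quadraticChar_one_iff_isSquare h0, ← hp]
    exact ⟨_, sq _⟩
  · rw [eq_comm, quadraticChar_neg_one_iff_not_isSquare]
    rintro ⟨y, hy⟩
    obtain ⟨p, hp⟩ := exists_aeval_eq_of_natDegree_minpoly_eq_finrank hx y
    exact h1 ⟨p, by rw [hp, hy, sq]⟩

theorem card_filter_minpoly_eq [Finite F] [Fintype K] {P : F[X]} (hm : P.Monic)
    (hi : Irreducible P) (hd : P.natDegree = Module.finrank F K) :
    (Finset.univ.filter fun x : K => minpoly F x = P).card = Module.finrank F K := by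
  have hdvd : P ∣ X ^ Fintype.card K - X := by
    have h1 := hi.natDegree_dvd_iff_dvd_X_pow_card_pow_sub_X.mp (dvd_of_eq hd)
    rwa [← Module.natCard_eq_pow_finrank, Nat.card_eq_fintype_card] at h1
  have hsplit : (P.map (algebraMap F K)).Splits := by
    have := FiniteField.isSplittingField_sub K F
    refine Splits.of_dvd (IsSplittingField.splits K (X ^ Fintype.card K - X : F[X])) ?_
      (map_dvd (mapRingHom (algebraMap F K)) hdvd)
    exact map_ne_zero (FiniteField.X_pow_card_sub_X_ne_zero F Fintype.one_lt_card)
  rw [← hd, ← card_rootSet_eq_natDegree (PerfectField.separable_of_irreducible hi) hsplit,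
    ← Set.toFinset_card]
  congr 1
  ext x
  rw [Set.mem_toFinset, mem_rootSet_of_ne hi.ne_zero]
  simp only [Finset.mem_filter, Finset.mem_univ, true_and]
  constructor
  · rintro rfl
    exact minpoly.aeval F x
  · exact fun h => (minpoly.eq_of_irreducible_of_monic hi h hm).symm

theorem pow_card_pow_natDegree_minpoly [Finite F] [FiniteDimensional F K] (x : K) :
    x ^ Nat.card F ^ (minpoly F x).natDegree = x := by
  have h1 := (minpoly.irreducible
    (Algebra.IsIntegral.isIntegral (R := F) x)).natDegree_dvd_iff_dvd_X_pow_card_pow_sub_X.mp dvd_rfl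
  rw [minpoly.dvd_iff] at h1
  simpa [sub_eq_zero] using h1

theorem sum_pow_range_succ_le {q : ℕ} (hq : 2 ≤ q) (k : ℕ) :
    ∑ d ∈ Finset.range (k + 1), q ^ d ≤ 2 * q ^ k := by
  induction k with
  | zero => simp
  | succ k ih =>
    rw [Finset.sum_range_succ, pow_succ]
    nlinarith [Nat.mul_le_mul_left (q ^ k) hq]

theorem card_filter_natDegree_minpoly_ne_le [Finite F] [Fintype K] :
    (Finset.univ.filter fun x : K => (minpoly F x).natDegree ≠ Module.finrank F K).card ≤
      2 * Nat.card F ^ (Module.finrank F K / 2) := by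
  have hq : 2 ≤ Nat.card F := Finite.one_lt_card
  set n := Module.finrank F K
  have hn : 0 < n := Module.finrank_pos
  have hsub : (Finset.univ.filter fun x : K => (minpoly F x).natDegree ≠ n) ⊆
      (Finset.range (n / 2 + 1)).biUnion fun d =>
        Finset.univ.filter fun x : K => x ^ Nat.card F ^ d = x ∧ d ≠ 0 := by
    intro x hx
    simp only [Finset.mem_filter, Finset.mem_univ, true_and, Finset.mem_biUnion,
      Finset.mem_range] at hx ⊢
    have hint := Algebra.IsIntegral.isIntegral (R := F) x
    refine ⟨(minpoly F x).natDegree, ?_, pow_card_pow_natDegree_minpoly x,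
      (minpoly.natDegree_pos hint).ne'⟩
    obtain ⟨c, hc⟩ := minpoly.degree_dvd hint
    change n = _ at hc
    have hc2 : 2 ≤ c := by
      rcases c with _ | _ | c
      · omega
      · omega
      · omega
    have := Nat.mul_le_mul_left (minpoly F x).natDegree hc2
    omega
  refine (Finset.card_le_card hsub).trans (Finset.card_biUnion_le.trans ?_)
  refine le_trans (Finset.sum_le_sum fun d _ => ?_) (sum_pow_range_succ_le hq (n / 2))
  rcases Nat.eq_zero_or_pos d with rfl | hd
  · simp
  · have hne := FiniteField.X_pow_card_pow_sub_X_ne_zero K hd.ne' (p := Nat.card F) hq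
    refine le_of_le_of_eq (card_le_degree_of_subset_roots fun x hx => ?_)
      (FiniteField.X_pow_card_pow_sub_X_natDegree_eq K hd.ne' (p := Nat.card F) hq)
    have hx' := (Finset.mem_filter.mp hx).2.1
    rw [mem_roots hne, IsRoot, eval_sub, eval_pow, eval_X, hx', sub_self]

theorem finrank_mul_sum_legendreSymbol [Finite F] [Fintype K] (B : F[X]) :
    (Module.finrank F K : ℤ) *
        ∑ᶠ P ∈ {P : F[X] | P.Monic ∧ Irreducible P ∧ P.natDegree = Module.finrank F K},
          legendreSymbol B P =
      ∑ x : K with (minpoly F x).natDegree = Module.finrank F K,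
        quadraticChar K (aeval x B) := by
  set S := Finset.univ.filter fun x : K => (minpoly F x).natDegree = Module.finrank F K with hS
  have hset : {P : F[X] | P.Monic ∧ Irreducible P ∧ P.natDegree = Module.finrank F K} =
      (S.image (minpoly F) : Finset F[X]) := by
    ext P
    simp only [Set.mem_ofPred_eq, Finset.coe_image, Set.mem_image, hS, Finset.mem_coe,
      Finset.mem_filter, Finset.mem_univ, true_and]
    constructor
    · rintro ⟨hm, hi, hd⟩
      have hcard := card_filter_minpoly_eq hm hi hd
      obtain ⟨x, hx⟩ := Finset.card_pos.mp (hcard ▸ Module.finrank_pos)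
      have hx' := (Finset.mem_filter.mp hx).2
      exact ⟨x, by rw [hx', hd], hx'⟩
    · rintro ⟨x, hx, rfl⟩
      have hint := Algebra.IsIntegral.isIntegral (R := F) x
      exact ⟨minpoly.monic hint, minpoly.irreducible hint, hx⟩
  have hmaps : ∀ x ∈ S, minpoly F x ∈ S.image (minpoly F) :=
    fun x hx => Finset.mem_image_of_mem (minpoly F) hx
  rw [hset, finsum_mem_coe_finset, Finset.mul_sum, ← Finset.sum_fiberwise_of_maps_to hmaps]
  refine Finset.sum_congr rfl fun P hP => ?_
  have hP' : P ∈ {P : F[X] | P.Monic ∧ Irreducible P ∧ P.natDegree = Module.finrank F K} := by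
    rw [hset]
    exact hP
  obtain ⟨hm, hi, hd⟩ := hP'
  have hfib : S.filter (fun x => minpoly F x = P) =
      Finset.univ.filter fun x : K => minpoly F x = P := by
    ext x
    simp only [hS, Finset.mem_filter, Finset.mem_univ, true_and, and_iff_right_iff_imp]
    rintro rfl
    exact hd
  have hval : ∀ x ∈ S.filter (fun x => minpoly F x = P),
      quadraticChar K (aeval x B) = legendreSymbol B P := fun x hx => by
    have hx' := (Finset.mem_filter.mp hx).2
    rw [← hx', legendreSymbol_minpoly_eq_quadraticChar (by rw [hx', hd])]
  rw [Finset.sum_congr rfl hval, Finset.sum_const, hfib, card_filter_minpoly_eq hm hi hd,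
    nsmul_eq_mul]

theorem finrank_mul_abs_sum_legendreSymbol_le [Fintype F] [Fintype K]
    (hodd : Odd (Fintype.card F)) {B : F[X]} (hB : B.Monic) (hm : 1 ≤ B.natDegree)
    (hsq : ¬ ∃ A : F[X], B = A ^ 2) :
    Module.finrank F K *
        |((∑ᶠ P ∈ {P : F[X] | P.Monic ∧ Irreducible P ∧ P.natDegree = Module.finrank F K},
          legendreSymbol B P : ℤ) : ℝ)| ≤
      25 * B.natDegree * √(Fintype.card F) ^ Module.finrank F K := by
  set n := Module.finrank F K
  have hcard : Fintype.card K = Fintype.card F ^ n := Module.card_eq_pow_finrank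
  have hoddK : Odd (Fintype.card K) := hcard ▸ hodd.pow
  have h2 : (2 : K) ≠ 0 := by
    apply Ring.two_ne_zero
    rw [Ne, FiniteField.even_card_iff_char_two]
    have := Nat.odd_iff.mp hoddK
    omega
  have hweil := abs_sum_quadraticChar_le (f := B.map (algebraMap F K)) hoddK (hB.map _)
    (by rwa [natDegree_map]) fun ⟨A, hA⟩ => hsq (exists_eq_sq_of_map_eq_sq h2 hB hA)
  have hroot : √(Fintype.card K : ℝ) = √(Fintype.card F) ^ n := by
    rw [hcard, Nat.cast_pow, Real.sqrt_eq_iff_mul_self_eq (by positivity) (by positivity),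
      ← mul_pow, Real.mul_self_sqrt (Nat.cast_nonneg _)]
  rw [natDegree_map, hroot] at hweil
  simp only [eval_map_algebraMap] at hweil
  have hsplit := Finset.sum_filter_add_sum_filter_not Finset.univ
    (fun x : K => (minpoly F x).natDegree = n) fun x => quadraticChar K (aeval x B)
  rw [← finrank_mul_sum_legendreSymbol B] at hsplit
  have hbad : |∑ x : K with ¬ (minpoly F x).natDegree = n, quadraticChar K (aeval x B)| ≤
      (2 * Fintype.card F ^ (n / 2) : ℕ) := by
    refine (Finset.abs_sum_le_sum_abs _ _).trans ?_
    refine le_trans ?_ (Nat.cast_le.mpr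
      (Nat.card_eq_fintype_card (α := F) ▸ card_filter_natDegree_minpoly_ne_le (F := F) (K := K)))
    rw [Finset.card_eq_sum_ones, Nat.cast_sum]
    refine Finset.sum_le_sum fun x _ => ?_
    by_cases h : aeval x B = 0
    · simp [h]
    · rcases quadraticChar_dichotomy h with h | h <;> simp [h]
  have hbad' : |((∑ x : K with ¬ (minpoly F x).natDegree = n, quadraticChar K (aeval x B) : ℤ) : ℝ)|
      ≤ 2 * (Fintype.card F : ℝ) ^ (n / 2) := by exact_mod_cast hbad
  have hr1 : 1 ≤ √(Fintype.card F : ℝ) :=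
    Real.one_le_sqrt.mpr (by exact_mod_cast Fintype.card_pos)
  have hpow : (Fintype.card F : ℝ) ^ (n / 2) ≤ √(Fintype.card F) ^ n := by
    calc (Fintype.card F : ℝ) ^ (n / 2) = √(Fintype.card F) ^ (2 * (n / 2)) := by
          rw [pow_mul, Real.sq_sqrt (Nat.cast_nonneg _)]
      _ ≤ √(Fintype.card F) ^ n := pow_le_pow_right₀ hr1 (by omega)
  have hm' : (1 : ℝ) ≤ B.natDegree := by exact_mod_cast hm
  have hmul : √(Fintype.card F : ℝ) ^ n ≤ B.natDegree * √(Fintype.card F) ^ n :=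
    le_mul_of_one_le_left (by positivity) hm'
  rw [← Nat.abs_cast n, ← abs_mul]
  have heq := congrArg (Int.cast : ℤ → ℝ) hsplit
  rw [Int.cast_add, Int.cast_mul, Int.cast_natCast] at heq
  rw [← heq] at hweil
  rw [abs_le] at hweil hbad' ⊢
  constructor <;> linarith [hweil.1, hweil.2, hbad'.1, hbad'.2]

end Extension

theorem char_sum_over_primes_bound :
    ∃ C : ℝ, ∀ (F : Type) (_ : Field F) (_ : Fintype F), Odd (Fintype.card F) →
      ∀ B : F[X], B.Monic → 1 ≤ B.natDegree → (¬ ∃ A : F[X], B = A ^ 2) →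
      ∀ n : ℕ, 1 ≤ n →
        |((∑ᶠ P ∈ {P : F[X] | P.Monic ∧ Irreducible P ∧ P.natDegree = n},
            legendreSymbol B P : ℤ) : ℝ)| ≤
          C * ((B.natDegree : ℝ) / n) * Real.sqrt (Fintype.card F) ^ n := by
  refine ⟨25, fun F _ _ hodd B hB hm hsq n hn => ?_⟩
  obtain ⟨p, hp⟩ := CharP.exists F
  have : Fact p.Prime := ⟨CharP.char_is_prime F p⟩
  have : NeZero n := ⟨by omega⟩
  have := Fintype.ofFinite (FiniteField.Extension F p n)
  have key := finrank_mul_abs_sum_legendreSymbol_le (K := FiniteField.Extension F p n) hodd hB hm hsq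
  rw [FiniteField.finrank_extension] at key
  have hn' : (0 : ℝ) < n := by exact_mod_cast hn
  rw [mul_div_assoc', div_mul_eq_mul_div, le_div_iff₀ hn', mul_comm]
  exact key
end

section
/- Let q be odd and g ≥ 1. For a monic irreducible polynomial P in F_q[x], the average over all monic squarefree Q of degree 2g+1 of the indicator that P does not divide Q equals |P|/(|P|+1) + O(q^{−2g}), where |P| = q^{deg P}. -/
open Polynomial
open scoped Classical

section Divisibility

variable {α : Type*} [CommMonoidWithZero α] [GCDMonoid α]

theorem dvd_of_mul_self_dvd_mul_self_mul_squarefree {a c b : α} (ha : a ≠ 0)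
    (hb : Squarefree b) (h : a * a ∣ c * c * b) : a ∣ c := by
  obtain ⟨x, y, hx, hy, hxy⟩ := extract_gcd a c
  generalize gcd a c = d at hx hy
  subst hx hy
  have hd : d ≠ 0 := left_ne_zero_of_mul ha
  have h' : x * x ∣ y * y * b := by
    have h2 : (d * d) * (x * x) ∣ (d * d) * (y * y * b) := by
      convert h using 1
      · exact mul_mul_mul_comm _ _ _ _
      · rw [← mul_assoc, mul_mul_mul_comm]
    exact (mul_dvd_mul_iff_left (mul_ne_zero hd hd)).1 h2
  have hrel : IsRelPrime x y := (gcd_isUnit_iff_isRelPrime).1 hxy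
  have hrel' : IsRelPrime (x * x) (y * y) :=
    IsRelPrime.mul_left (hrel.mul_right hrel) (hrel.mul_right hrel)
  have hu : IsUnit x := hb x (hrel'.dvd_of_dvd_mul_left h')
  exact mul_dvd_mul_left d hu.dvd

end Divisibility

section Counting

variable {F : Type*} [Field F]

theorem Polynomial.Monic.eq_and_eq_of_mul_self_mul_squarefree_eq {a b c d : F[X]}
    (ha : a.Monic) (hc : c.Monic) (hb : Squarefree b) (hd : Squarefree d)
    (h : a * a * b = c * c * d) : a = c ∧ b = d := by
  let _ : GCDMonoid F[X] := UniqueFactorizationMonoid.toGCDMonoid _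
  have hac : a ∣ c := dvd_of_mul_self_dvd_mul_self_mul_squarefree ha.ne_zero hd
    (h ▸ dvd_mul_right _ _)
  have hca : c ∣ a := dvd_of_mul_self_dvd_mul_self_mul_squarefree hc.ne_zero hb
    (h ▸ dvd_mul_right _ _)
  obtain rfl := eq_of_monic_of_associated ha hc (associated_of_dvd_dvd hac hca)
  exact ⟨rfl, mul_left_cancel₀ (mul_ne_zero ha.ne_zero ha.ne_zero) h⟩

theorem Polynomial.Monic.exists_eq_mul_self_mul_squarefree {f : F[X]} (hf : f.Monic) :
    ∃ a b : F[X], a.Monic ∧ b.Monic ∧ Squarefree b ∧ f = a * a * b := by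
  induction hn : f.natDegree using Nat.strong_induction_on generalizing f with
  | _ n ih =>
    by_cases hsq : Squarefree f
    · exact ⟨1, f, monic_one, hf, hsq, by simp⟩
    · simp only [Squarefree, not_forall] at hsq
      obtain ⟨x, ⟨y, hxy⟩, hx⟩ := hsq
      have hx0 : x ≠ 0 := by
        rintro rfl
        exact hf.ne_zero (by simpa using hxy)
      have hm : (normalize x).Monic := monic_normalize hx0
      obtain ⟨h, hh⟩ : normalize x * normalize x ∣ f :=
        (mul_dvd_mul (normalize_dvd_iff.2 dvd_rfl) (normalize_dvd_iff.2 dvd_rfl)).trans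
          (Dvd.intro y hxy.symm)
      have hhm : h.Monic := (hm.mul hm).of_mul_monic_left (hh ▸ hf)
      have hpos : 0 < (normalize x).natDegree := by
        refine hm.natDegree_pos_of_not_isUnit ?_
        rwa [(normalize_associated x).isUnit_iff]
      have hdeg : f.natDegree = (normalize x).natDegree + (normalize x).natDegree
          + h.natDegree := by
        rw [hh, (hm.mul hm).natDegree_mul hhm, hm.natDegree_mul hm]
      obtain ⟨a, b, ha, hb, hbs, hab⟩ := ih h.natDegree (by omega) hhm rfl
      exact ⟨normalize x * a, b, hm.mul ha, hb, hbs, by rw [hh, hab]; ring⟩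

variable (F) in
/-- The monic squarefree polynomials of degree `n`. -/
def monicSquarefree (n : ℕ) : Set F[X] := {Q | Q.Monic ∧ Squarefree Q ∧ Q.natDegree = n}

/-- Every monic polynomial is uniquely a square of a monic polynomial times a monic
squarefree polynomial. -/
theorem bijective_mul_self_mul_monicSquarefree (n : ℕ) :
    Function.Bijective (fun x : Σ k : Fin (n / 2 + 1),
        {p : F[X] // p.Monic ∧ p.natDegree = k} × monicSquarefree F (n - 2 * k) =>
      (⟨x.2.1.1 * x.2.1.1 * x.2.2.1, by
        obtain ⟨k, ⟨a, ha, hak⟩, b, hb, hbs, hbk⟩ := x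
        refine ⟨(ha.mul ha).mul hb, ?_⟩
        rw [(ha.mul ha).natDegree_mul hb, ha.natDegree_mul ha]
        have : (k : ℕ) < n / 2 + 1 := k.2
        change a.natDegree + a.natDegree + b.natDegree = n
        omega⟩ : {p : F[X] // p.Monic ∧ p.natDegree = n})) := by
  constructor
  · rintro ⟨⟨k, hk⟩, ⟨a, ha, hak⟩, b, hb, hbs, hbk⟩ ⟨⟨l, hl⟩, ⟨c, hc, hcl⟩, d, hd, hds, hdl⟩ h
    dsimp only at hak hcl
    obtain ⟨rfl, rfl⟩ := ha.eq_and_eq_of_mul_self_mul_squarefree_eq hc hbs hds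
      (congrArg Subtype.val h)
    subst hak
    subst hcl
    rfl
  · rintro ⟨f, hf, hfn⟩
    obtain ⟨a, b, ha, hb, hbs, rfl⟩ := hf.exists_eq_mul_self_mul_squarefree
    rw [(ha.mul ha).natDegree_mul hb, ha.natDegree_mul ha] at hfn
    exact ⟨⟨⟨a.natDegree, by omega⟩, ⟨a, ha, rfl⟩, b, hb, hbs, show b.natDegree = n - 2 * a.natDegree by omega⟩, rfl⟩

/-- The monic squarefree polynomials of degree `n` not divisible by `P`. -/
def monicSquarefreeNotDvd (P : F[X]) (n : ℕ) : Set F[X] := {Q ∈ monicSquarefree F n | ¬ P ∣ Q}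

theorem monicSquarefreeNotDvd_of_lt {P : F[X]} {n : ℕ} (h : n < P.natDegree) :
    monicSquarefreeNotDvd P n = monicSquarefree F n := by
  refine Set.sep_eq_self_iff_mem_true.2 fun Q hQ hPQ => ?_
  have := natDegree_le_of_dvd hPQ hQ.1.ne_zero
  have := hQ.2.2
  omega

variable [Fintype F]

instance finite_monic_natDegree_eq (n : ℕ) : Finite {p : F[X] // p.Monic ∧ p.natDegree = n} :=
  Finite.of_equiv (Fin n → F)
    ((monicEquivDegreeLT n).trans (degreeLTEquiv F n).toEquiv).symm

theorem card_monic_natDegree_eq (n : ℕ) :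
    Nat.card {p : F[X] // p.Monic ∧ p.natDegree = n} = Fintype.card F ^ n := by
  rw [Nat.card_congr ((monicEquivDegreeLT n).trans (degreeLTEquiv F n).toEquiv)]
  simp

theorem finite_monicSquarefree (n : ℕ) : (monicSquarefree F n).Finite :=
  (Set.finite_coe_iff.1 (finite_monic_natDegree_eq (F := F) n)).subset fun _ h => ⟨h.1, h.2.2⟩

theorem sum_card_pow_mul_ncard_monicSquarefree (n : ℕ) :
    ∑ k ∈ Finset.range (n / 2 + 1),
      Fintype.card F ^ k * (monicSquarefree F (n - 2 * k)).ncard = Fintype.card F ^ n := by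
  have (k : ℕ) : Finite (monicSquarefree F k) := finite_monicSquarefree k
  rw [← card_monic_natDegree_eq n,
    ← Nat.card_congr (Equiv.ofBijective _ (bijective_mul_self_mul_monicSquarefree (F := F) n)),
    Nat.card_sigma, ← Fin.sum_univ_eq_sum_range
      (fun k => Fintype.card F ^ k * (monicSquarefree F (n - 2 * k)).ncard)]
  refine Finset.sum_congr rfl fun k _ => ?_
  rw [Nat.card_prod, card_monic_natDegree_eq, Nat.card_coe_set_eq]

theorem ncard_monicSquarefree_zero : (monicSquarefree F 0).ncard = 1 := by
  simpa using sum_card_pow_mul_ncard_monicSquarefree (F := F) 0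

theorem ncard_monicSquarefree_one : (monicSquarefree F 1).ncard = Fintype.card F := by
  simpa using sum_card_pow_mul_ncard_monicSquarefree (F := F) 1

theorem ncard_monicSquarefree_add_two (n : ℕ) :
    (monicSquarefree F (n + 2)).ncard + Fintype.card F ^ (n + 1) = Fintype.card F ^ (n + 2) := by
  rw [← sum_card_pow_mul_ncard_monicSquarefree (n + 2), show (n + 2) / 2 = n / 2 + 1 by omega,
    Finset.sum_range_succ', pow_succ', ← sum_card_pow_mul_ncard_monicSquarefree n,
    Finset.mul_sum, add_comm]
  congr 1
  · refine Finset.sum_congr rfl fun k _ => ?_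
    rw [show n + 2 - 2 * (k + 1) = n - 2 * k by omega, pow_succ']
    ring
  · simp

theorem ncard_monicSquarefreeNotDvd_add {P : F[X]} (hP : P.Monic) (hP' : Irreducible P) (n : ℕ) :
    (monicSquarefreeNotDvd P (n + P.natDegree)).ncard + (monicSquarefreeNotDvd P n).ncard =
      (monicSquarefree F (n + P.natDegree)).ncard := by
  have himg : (fun Q => P * Q) '' monicSquarefreeNotDvd P n =
      {Q ∈ monicSquarefree F (n + P.natDegree) | P ∣ Q} := by
    ext Q
    constructor
    · rintro ⟨R, ⟨⟨hR, hRs, hRn⟩, hPR⟩, rfl⟩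
      refine ⟨⟨hP.mul hR, ?_, ?_⟩, dvd_mul_right _ _⟩
      · exact squarefree_mul_iff.2 ⟨hP'.isRelPrime_iff_not_dvd.2 hPR, hP'.squarefree, hRs⟩
      · rw [hP.natDegree_mul hR, hRn, add_comm]
    · rintro ⟨⟨hQ, hQs, hQn⟩, R, rfl⟩
      have hR := hP.of_mul_monic_left hQ
      rw [hP.natDegree_mul hR] at hQn
      obtain ⟨hrel, -, hRs⟩ := squarefree_mul_iff.1 hQs
      exact ⟨R, ⟨⟨hR, hRs, by omega⟩, hP'.isRelPrime_iff_not_dvd.1 hrel⟩, rfl⟩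
  rw [← Set.ncard_image_of_injective (monicSquarefreeNotDvd P n)
    (mul_right_injective₀ hP.ne_zero), himg, add_comm]
  have hfin := finite_monicSquarefree (F := F) (n + P.natDegree)
  rw [monicSquarefreeNotDvd, ← Set.ncard_union_eq _ (hfin.sep _) (hfin.sep _)]
  · congr 1
    ext Q
    simp only [Set.mem_union, Set.mem_ofPred_eq]
    tauto
  · exact Set.disjoint_left.2 fun Q h h' => h'.2 h.2

theorem abs_ncard_monicSquarefreeNotDvd_sub_le {P : F[X]} (hP : P.Monic) (hP' : Irreducible P)
    (n : ℕ) :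
    |((monicSquarefreeNotDvd P n).ncard : ℝ) -
      (Fintype.card F : ℝ) ^ n * (1 - 1 / Fintype.card F) *
        ((Fintype.card F : ℝ) ^ P.natDegree / ((Fintype.card F : ℝ) ^ P.natDegree + 1))| ≤ 3 := by
  have hq : (1 : ℝ) < Fintype.card F := by exact_mod_cast Fintype.one_lt_card
  have hSn (m : ℕ) : ((monicSquarefree F (m + 2)).ncard : ℝ) =
      (Fintype.card F : ℝ) ^ (m + 2) * (1 - 1 / Fintype.card F) := by
    have h : ((monicSquarefree F (m + 2)).ncard : ℝ) + (Fintype.card F : ℝ) ^ (m + 1) =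
      (Fintype.card F : ℝ) ^ (m + 2) := by exact_mod_cast ncard_monicSquarefree_add_two m
    rw [eq_sub_of_add_eq h]
    field_simp
    ring
  have hS (m : ℕ) : |((monicSquarefree F m).ncard : ℝ) -
      (Fintype.card F : ℝ) ^ m * (1 - 1 / Fintype.card F)| ≤ 1 := by
    match m with
    | 0 =>
      rw [ncard_monicSquarefree_zero]
      have h1 : 1 / (Fintype.card F : ℝ) ≤ 1 := (div_le_one (by linarith)).2 hq.le
      have h0 : 0 ≤ 1 / (Fintype.card F : ℝ) := by positivity
      rw [abs_le]
      simp only [pow_zero, Nat.cast_one, one_mul]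
      constructor <;> linarith
    | 1 =>
      rw [ncard_monicSquarefree_one]
      refine (congrArg _ ?_).trans_le abs_one.le
      field_simp
      ring
    | m + 2 => simp [hSn]
  have hd : 0 < P.natDegree := hP'.natDegree_pos
  have hrec (m : ℕ) : ((monicSquarefreeNotDvd P (m + P.natDegree)).ncard : ℝ) +
      (monicSquarefreeNotDvd P m).ncard = (monicSquarefree F (m + P.natDegree)).ncard := by
    exact_mod_cast ncard_monicSquarefreeNotDvd_add hP hP' m
  set q : ℝ := (Fintype.card F : ℝ)
  set A : ℝ := q ^ P.natDegree with hA
  have hApos : 0 < A := by positivity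
  have hsplit (m : ℕ) : q ^ (m + P.natDegree) * (1 - 1 / q) * (A / (A + 1)) +
      q ^ m * (1 - 1 / q) * (A / (A + 1)) = q ^ (m + P.natDegree) * (1 - 1 / q) := by
    rw [pow_add, ← hA]
    field_simp
  have hsmall (m : ℕ) (hm : m < P.natDegree) :
      |((monicSquarefreeNotDvd P m).ncard : ℝ) - q ^ m * (1 - 1 / q) * (A / (A + 1))| ≤ 2 := by
    rw [monicSquarefreeNotDvd_of_lt hm]
    have hle : q ^ m ≤ A := pow_le_pow_right₀ hq.le hm.le
    have h1 : 1 / q ≤ 1 := (div_le_one (by linarith)).2 hq.le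
    have h0 : 0 ≤ 1 / q := by positivity
    have hpos : 0 < q ^ m := by positivity
    have e : q ^ m * (1 - 1 / q) * (A / (A + 1)) =
        q ^ m * (1 - 1 / q) - q ^ m * (1 - 1 / q) / (A + 1) := by
      field_simp
      ring
    have hb : q ^ m * (1 - 1 / q) / (A + 1) ≤ 1 := by
      rw [div_le_one (by positivity)]
      nlinarith
    have hb' : 0 ≤ q ^ m * (1 - 1 / q) / (A + 1) :=
      div_nonneg (mul_nonneg hpos.le (by linarith)) (by positivity)
    have := abs_le.1 (hS m)
    rw [e, abs_le]
    constructor <;> linarith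
  induction n using Nat.strong_induction_on with
  | _ n ih =>
    rcases lt_or_ge n P.natDegree with hn | hn
    · linarith [hsmall n hn]
    obtain ⟨m, rfl⟩ := Nat.exists_eq_add_of_le' hn
    have h1 := hrec m
    have h2 := hsplit m
    rcases Nat.eq_zero_or_pos m with rfl | hm
    · have h3 := abs_le.1 (hsmall 0 hd)
      have h4 := abs_le.1 (hS (0 + P.natDegree))
      rw [abs_le]
      constructor <;> linarith
    · have h3 := abs_le.1 (ih m (by omega))
      have h4 := hSn (m + P.natDegree - 2)
      rw [Nat.sub_add_cancel (by omega)] at h4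
      rw [abs_le]
      constructor <;> linarith

theorem finsum_mem_monicSquarefree_indicator (P : F[X]) (n : ℕ) :
    ∑ᶠ Q ∈ monicSquarefree F n, (if P ∣ Q then (0 : ℝ) else 1) =
      (monicSquarefreeNotDvd P n).ncard := by
  have hfin := finite_monicSquarefree (F := F) n
  have hset : monicSquarefreeNotDvd P n = ↑(hfin.toFinset.filter fun Q => ¬ P ∣ Q) := by
    ext Q
    simp [monicSquarefreeNotDvd]
  rw [finsum_mem_eq_finite_toFinset_sum _ hfin, hset, Set.ncard_coe_finset,
    Finset.natCast_card_filter]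
  simp only [ite_not]

end Counting

/-- For `q` odd and `g ≥ 1`, the average over all monic squarefree `Q` of degree
`2g+1` of the indicator of `P ∤ Q` equals `|P|/(|P|+1) + O(q^{-2g})`, where
`|P| = q^{deg P}`. -/
theorem average_indicator_not_dvd (F : Type*) [Field F] [Fintype F]
    (hq : Odd (Fintype.card F)) :
    ∃ C : ℝ, ∀ g : ℕ, 1 ≤ g → ∀ P : F[X], P.Monic → Irreducible P →
      |(∑ᶠ Q ∈ {Q : F[X] | Q.Monic ∧ Squarefree Q ∧ Q.natDegree = 2 * g + 1},
            (if P ∣ Q then (0 : ℝ) else 1)) /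
          ({Q : F[X] | Q.Monic ∧ Squarefree Q ∧ Q.natDegree = 2 * g + 1}.ncard : ℝ) -
        (Fintype.card F : ℝ) ^ P.natDegree / ((Fintype.card F : ℝ) ^ P.natDegree + 1)| ≤
      C / (Fintype.card F : ℝ) ^ (2 * g) := by
  refine ⟨3, fun g hg P hP hP' => ?_⟩
  obtain ⟨k, rfl⟩ := Nat.exists_eq_add_of_le' hg
  have hsum := finsum_mem_monicSquarefree_indicator P (2 * (k + 1) + 1)
  have hcard : ((monicSquarefree F (2 * (k + 1) + 1)).ncard : ℝ) +
      (Fintype.card F : ℝ) ^ (2 * (k + 1)) = (Fintype.card F : ℝ) ^ (2 * (k + 1) + 1) := by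
    exact_mod_cast ncard_monicSquarefree_add_two (F := F) (2 * k + 1)
  have hbound := abs_ncard_monicSquarefreeNotDvd_sub_le hP hP' (2 * (k + 1) + 1)
  rw [monicSquarefree] at hsum hcard
  rw [hsum]
  have hq2 : (2 : ℝ) ≤ Fintype.card F := by exact_mod_cast Fintype.one_lt_card (α := F)
  set q : ℝ := (Fintype.card F : ℝ)
  set r : ℝ := q ^ P.natDegree / (q ^ P.natDegree + 1)
  set S : ℝ := ({Q : F[X] | Q.Monic ∧ Squarefree Q ∧ Q.natDegree = 2 * (k + 1) + 1}.ncard : ℝ)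
  have hpow : 0 < q ^ (2 * (k + 1)) := by positivity
  have hS : S = q ^ (2 * (k + 1) + 1) * (1 - 1 / q) := by
    rw [eq_sub_of_add_eq hcard]
    field_simp
    ring
  have hle : q ^ (2 * (k + 1)) ≤ S := by
    rw [pow_succ] at hcard
    nlinarith
  have hSpos : 0 < S := hpow.trans_le hle
  rw [← hS] at hbound
  rw [div_sub' hSpos.ne', abs_div, abs_of_pos hSpos]
  exact div_le_div₀ (by norm_num) hbound hpow hle
end
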